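/- arXiv:1102.0677 — 2 statements merged into one kernel-verified Lean document; each statement's English description precedes it below -/
import Mathlib

section
/- Let 1 ≤ p1 < 2 < p2 < ∞. Then there exists a constant C > 0, independent of N and n, such that for all N, n ∈ ℕ the Kolmogorov numbers satisfy: d_n(id : ℓ_{p1}^N → ℓ_{p2}^N) ≤ C if n ≤ N^{2/p2}; d_n(id : ℓ_{p1}^N → ℓ_{p2}^N) ≤ C N^{1/p2} n^{-1/2} if N^{2/p2} < n ≤ N; and d_n(id : ℓ_{p1}^N → ℓ_{p2}^N) = 0 if n > N. -/
open scoped ENNReal Classical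

/-- The `ℓ_p` norm on `ℂ^N`, for `p ∈ [1, ∞]` (`p = ∞` gives the sup-norm). -/
noncomputable def lpNorm (p : ℝ≥0∞) {N : ℕ} (x : Fin N → ℂ) : ℝ :=
  if p = ∞ then ⨆ i, ‖x i‖ else (∑ i, ‖x i‖ ^ p.toReal) ^ (1 / p.toReal)

/-- The `n`-th Kolmogorov number of the identity map `id : ℓ_{p1}^N → ℓ_{p2}^N`:
the infimum, over all linear subspaces `L` of `ℓ_{p2}^N` of dimension `< n`, of
`sup_{‖x‖_{p1} ≤ 1} inf_{y ∈ L} ‖x - y‖_{p2}`. -/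
noncomputable def kolmogorovLp (p1 p2 : ℝ≥0∞) (N n : ℕ) : ℝ :=
  sInf { r : ℝ | ∃ L : Submodule ℂ (Fin N → ℂ), Module.finrank ℂ L < n ∧
    r = sSup { t : ℝ | ∃ x : Fin N → ℂ, lpNorm p1 x ≤ 1 ∧
      t = sInf { s : ℝ | ∃ y ∈ L, s = lpNorm p2 (x - y) } } }

/-- The Rademacher sum `∑ ± y j` with signs prescribed by `ε`. -/
noncomputable def signSum {N : ℕ} (y : Fin N → ℝ) (ε : Fin N → Bool) : ℝ :=
  ∑ j, (if ε j then 1 else -1) * y j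

lemma sum_signSum_succ {N : ℕ} (y : Fin (N + 1) → ℝ) (f : ℝ → ℝ) :
    ∑ ε, f (signSum y ε) =
      ∑ ε, (f (y 0 + signSum (fun j => y j.succ) ε) +
        f (-y 0 + signSum (fun j => y j.succ) ε)) := by
  rw [← (Fin.consEquiv fun _ : Fin (N + 1) => Bool).sum_comp, Fintype.sum_prod_type]
  simp [signSum, Fin.sum_univ_succ, Finset.sum_add_distrib]

lemma sum_signSum_sq {N : ℕ} (y : Fin N → ℝ) :
    ∑ ε, signSum y ε ^ 2 = 2 ^ N * ∑ j, y j ^ 2 := by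
  induction N with
  | zero => simp [signSum]
  | succ N ih =>
    have h := sum_signSum_succ y (fun s => s ^ 2)
    rw [h, Fin.sum_univ_succ, mul_add, pow_succ, mul_assoc _ _ (∑ j, _), mul_left_comm,
      ← ih fun j => y j.succ]
    have : ∀ ε, (y 0 + signSum (fun j => y j.succ) ε) ^ 2 +
        (-y 0 + signSum (fun j => y j.succ) ε) ^ 2 =
        2 * signSum (fun j => y j.succ) ε ^ 2 + 2 * y 0 ^ 2 := fun ε => by ring
    simp only [this, Finset.sum_add_distrib, ← Finset.mul_sum]
    simp
    ring

lemma sum_signSum_pow_four_le {N : ℕ} (y : Fin N → ℝ) :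
    ∑ ε, signSum y ε ^ 4 ≤ 2 ^ N * (3 * (∑ j, y j ^ 2) ^ 2) := by
  induction N with
  | zero => simp [signSum]
  | succ N ih =>
    have h := sum_signSum_succ y (fun s => s ^ 4)
    have : ∀ ε, (y 0 + signSum (fun j => y j.succ) ε) ^ 4 +
        (-y 0 + signSum (fun j => y j.succ) ε) ^ 4 =
        2 * signSum (fun j => y j.succ) ε ^ 4 +
          12 * y 0 ^ 2 * signSum (fun j => y j.succ) ε ^ 2 + 2 * y 0 ^ 4 := fun ε => by ring
    rw [h]
    simp only [this, Finset.sum_add_distrib, ← Finset.mul_sum, sum_signSum_sq]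
    have ih' := ih fun j => y j.succ
    rw [Fin.sum_univ_succ]
    simp only [Finset.sum_const, Finset.card_univ, Fintype.card_pi, Fintype.card_bool,
      Finset.prod_const, Fintype.card_fin, nsmul_eq_mul]
    push_cast
    have h4 : (0 : ℝ) ≤ 2 ^ N * y 0 ^ 4 := by positivity
    rw [pow_succ (2 : ℝ) N]
    nlinarith

lemma sum_exp_neg_signSum_sq_le {N : ℕ} (y : Fin N → ℝ) (hy : 0 < ∑ j, y j ^ 2) :
    ∑ ε, Real.exp (-(signSum y ε ^ 2 / (3 * ∑ j, y j ^ 2))) ≤ 5 / 6 * 2 ^ N := by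
  set σ := ∑ j, y j ^ 2 with hσ
  have hexp : ∀ u : ℝ, 0 ≤ u → Real.exp (-u) ≤ 1 - u + u ^ 2 / 2 := by
    intro u hu
    rw [Real.exp_neg, inv_le_comm₀ (Real.exp_pos _) (by nlinarith [sq_nonneg (u - 1)])]
    refine le_trans ?_ (Real.quadratic_le_exp_of_nonneg hu)
    rw [inv_le_iff_one_le_mul₀ (by nlinarith [sq_nonneg (u - 1)])]
    nlinarith [sq_nonneg (u ^ 2)]
  calc ∑ ε, Real.exp (-(signSum y ε ^ 2 / (3 * σ)))
      ≤ ∑ ε, (1 - signSum y ε ^ 2 / (3 * σ) + (signSum y ε ^ 2 / (3 * σ)) ^ 2 / 2) :=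
        Finset.sum_le_sum fun ε _ => hexp _ (by positivity)
    _ = 2 ^ N - (∑ ε, signSum y ε ^ 2) / (3 * σ) + (∑ ε, signSum y ε ^ 4) / (18 * σ ^ 2) := by
        rw [Finset.sum_add_distrib, Finset.sum_sub_distrib, Finset.sum_div, Finset.sum_div]
        congr 1
        · simp
        · refine Finset.sum_congr rfl fun ε _ => ?_
          field_simp
          ring
    _ ≤ 2 ^ N - (2 ^ N * σ) / (3 * σ) + (2 ^ N * (3 * σ ^ 2)) / (18 * σ ^ 2) := by
        rw [sum_signSum_sq]
        gcongr
        exact sum_signSum_pow_four_le y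
    _ = 5 / 6 * 2 ^ N := by
        field_simp
        ring

lemma sum_exp_mul_signSum_sq_le {N : ℕ} (y : Fin N → ℝ) (a : ℝ) (ha : 0 ≤ a)
    (h : 2 * a * ∑ j, y j ^ 2 < 1) :
    ∑ ε, Real.exp (a * signSum y ε ^ 2) ≤
      2 ^ N * Real.exp (a * (∑ j, y j ^ 2) / (1 - 2 * a * ∑ j, y j ^ 2)) := by
  induction N generalizing a with
  | zero => simp [signSum]
  | succ N ih =>
    have hs := sum_signSum_succ y (fun s => Real.exp (a * s ^ 2))
    rw [hs]
    rw [Fin.sum_univ_succ] at h ⊢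
    set σ := ∑ j : Fin N, y j.succ ^ 2 with hσ
    have hσ0 : 0 ≤ σ := by positivity
    set b := a * (1 + 2 * a * y 0 ^ 2) with hb
    have hy0 := sq_nonneg (y 0)
    have hay : 0 ≤ a * y 0 ^ 2 := by positivity
    have haσ : 0 ≤ a * σ := by positivity
    have hbσ : b * σ * (1 - 2 * a * y 0 ^ 2) ≤ a * σ := by
      have : b * σ * (1 - 2 * a * y 0 ^ 2) = a * σ * (1 - (2 * a * y 0 ^ 2) ^ 2) := by
        rw [hb]; ring
      rw [this]
      exact mul_le_of_le_one_right haσ (by nlinarith [sq_nonneg (2 * a * y 0 ^ 2)])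
    have hD : 0 < 1 - 2 * a * (y 0 ^ 2 + σ) := by linarith
    have hb1 : 2 * b * σ < 1 := by
      by_contra hcon
      have : 1 * (1 - 2 * a * y 0 ^ 2) ≤ 2 * b * σ * (1 - 2 * a * y 0 ^ 2) :=
        mul_le_mul_of_nonneg_right (not_lt.mp hcon) (by nlinarith)
      nlinarith
    have hpt : ∀ ε, Real.exp (a * (y 0 + signSum (fun j => y j.succ) ε) ^ 2) +
        Real.exp (a * (-y 0 + signSum (fun j => y j.succ) ε) ^ 2) ≤
        2 * Real.exp (a * y 0 ^ 2) * Real.exp (b * signSum (fun j => y j.succ) ε ^ 2) := by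
      intro ε
      set s := signSum (fun j => y j.succ) ε
      have hc := Real.cosh_le_exp_half_sq (2 * a * s * y 0)
      rw [Real.cosh_eq] at hc
      have e1 : Real.exp (a * (y 0 + s) ^ 2) =
          Real.exp (a * y 0 ^ 2 + a * s ^ 2) * Real.exp (2 * a * s * y 0) := by
        rw [← Real.exp_add]; ring_nf
      have e2 : Real.exp (a * (-y 0 + s) ^ 2) =
          Real.exp (a * y 0 ^ 2 + a * s ^ 2) * Real.exp (-(2 * a * s * y 0)) := by
        rw [← Real.exp_add]; ring_nf
      have e3 : 2 * Real.exp (a * y 0 ^ 2) * Real.exp (b * s ^ 2) =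
          Real.exp (a * y 0 ^ 2 + a * s ^ 2) * (2 * Real.exp ((2 * a * s * y 0) ^ 2 / 2)) := by
        rw [mul_assoc, ← Real.exp_add, mul_left_comm, ← Real.exp_add, hb]; ring_nf
      rw [e1, e2, e3, ← mul_add]
      gcongr
      linarith
    refine (Finset.sum_le_sum fun ε _ => hpt ε).trans ?_
    rw [← Finset.mul_sum]
    have hb0 : 0 ≤ b := by positivity
    have ih' := ih (fun j => y j.succ) b hb0 hb1
    rw [← hσ] at ih'
    calc 2 * Real.exp (a * y 0 ^ 2) * ∑ ε, Real.exp (b * signSum (fun j => y j.succ) ε ^ 2)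
        ≤ 2 * Real.exp (a * y 0 ^ 2) * (2 ^ N * Real.exp (b * σ / (1 - 2 * b * σ))) := by gcongr
      _ = 2 ^ (N + 1) * Real.exp (a * y 0 ^ 2 + b * σ / (1 - 2 * b * σ)) := by
          rw [Real.exp_add]; ring
      _ ≤ _ := by
          gcongr
          rw [mul_add a, add_div]
          have h1 : a * y 0 ^ 2 ≤ a * y 0 ^ 2 / (1 - 2 * a * (y 0 ^ 2 + σ)) :=
            le_div_self hay hD (by nlinarith)
          have h2 : b * σ / (1 - 2 * b * σ) ≤ a * σ / (1 - 2 * a * (y 0 ^ 2 + σ)) := by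
            rw [div_le_div_iff₀ (by linarith) hD]
            nlinarith
          linarith

lemma sum_exp_signSum_sq_le {N : ℕ} (y : Fin N → ℝ) (hy : 0 < ∑ j, y j ^ 2) :
    ∑ ε, Real.exp (signSum y ε ^ 2 / (4 * ∑ j, y j ^ 2)) ≤ Real.exp (1 / 2) * 2 ^ N := by
  have h := sum_exp_mul_signSum_sq_le y (1 / (4 * ∑ j, y j ^ 2)) (by positivity)
    (by field_simp; norm_num)
  have e : 1 / (4 * ∑ j, y j ^ 2) * (∑ j, y j ^ 2) /
      (1 - 2 * (1 / (4 * ∑ j, y j ^ 2)) * ∑ j, y j ^ 2) = 1 / 2 := by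
    field_simp
    norm_num
  rw [e, mul_comm (2 ^ N)] at h
  refine le_trans (le_of_eq (Finset.sum_congr rfl fun ε _ => ?_)) h
  rw [div_eq_inv_mul, one_div]

/-- Independence of the rows of a sign matrix, for exponential moments. -/
lemma sum_exp_sum_rows {Ω : Type*} [Fintype Ω] (m : ℕ) (g : Ω → ℝ) :
    ∑ A : Fin m → Ω, Real.exp (∑ i, g (A i)) = (∑ ω, Real.exp (g ω)) ^ m := by
  rw [Fintype.sum_pow]
  simp only [Real.exp_sum]

/-- Integer vectors of length `N` with `ℓ_1`-norm at most `t`. -/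
noncomputable def intL1Ball (N t : ℕ) : Finset (Fin N → ℤ) :=
  (Fintype.piFinset fun _ => Finset.Icc (-(t : ℤ)) t).filter fun v => ∑ j, (v j).natAbs ≤ t

lemma mem_intL1Ball {N t : ℕ} {v : Fin N → ℤ} :
    v ∈ intL1Ball N t ↔ ∑ j, (v j).natAbs ≤ t := by
  simp only [intL1Ball, Finset.mem_filter, Fintype.mem_piFinset, Finset.mem_Icc,
    and_iff_right_iff_imp]
  intro h j
  have : (v j).natAbs ≤ ∑ j, (v j).natAbs :=
    Finset.single_le_sum (f := fun j => (v j).natAbs) (fun _ _ => Nat.zero_le _)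
      (Finset.mem_univ j)
  omega

lemma sum_pow_natAbs_Icc_le (t : ℕ) (x : ℝ) (hx0 : 0 ≤ x) (hx : x ≤ 1 / 2) :
    ∑ k ∈ Finset.Icc (-(t : ℤ)) t, x ^ k.natAbs ≤ 1 + 4 * x := by
  have key : ∀ t : ℕ, ∑ k ∈ Finset.Icc (-(t : ℤ)) t, x ^ k.natAbs + 4 * x ^ (t + 1) ≤
      1 + 4 * x := by
    intro t
    induction t with
    | zero => simp
    | succ t ih =>
      have e : Finset.Icc (-((t + 1 : ℕ) : ℤ)) ((t + 1 : ℕ) : ℤ) =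
          insert (-((t + 1 : ℕ) : ℤ)) (insert ((t + 1 : ℕ) : ℤ)
            (Finset.Icc (-(t : ℤ)) t)) := by
        ext k
        simp only [Finset.mem_Icc, Finset.mem_insert]
        omega
      rw [e, Finset.sum_insert, Finset.sum_insert]
      · have : x ^ (t + 1 + 1) ≤ x ^ (t + 1) * (1 / 2) := by
          rw [pow_succ]
          gcongr
        simp only [Int.natAbs_neg, Int.natAbs_natCast]
        linarith
      · simp
      · simp only [Finset.mem_Icc, Finset.mem_insert]
        omega
  have := key t
  have : 0 ≤ x ^ (t + 1) := by positivity
  linarith [key t]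

lemma card_intL1Ball_le {N t : ℕ} (ht : 1 ≤ t) (htN : t ≤ N) {q : ℝ} (hq : 2 < q) :
    ((intL1Ball N t).card : ℝ) ≤
      Real.exp ((2 + 2 * q) * ((t : ℝ) ^ (1 - 1 / q) * (N : ℝ) ^ (1 / q))) := by
  have ht0 : (0 : ℝ) < t := by exact_mod_cast ht
  have hN0 : (0 : ℝ) < N := by exact_mod_cast ht.trans htN
  have htN' : (t : ℝ) ≤ N := by exact_mod_cast htN
  set x : ℝ := t / (2 * N) with hx
  have hx0 : 0 < x := by positivity
  have hx2 : x ≤ 1 / 2 := by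
    rw [hx, div_le_div_iff₀ (by positivity) (by norm_num)]
    linarith
  have h1 : ((intL1Ball N t).card : ℝ) * x ^ t ≤ (1 + 4 * x) ^ N := by
    calc ((intL1Ball N t).card : ℝ) * x ^ t = ∑ v ∈ intL1Ball N t, x ^ t := by simp
      _ ≤ ∑ v ∈ intL1Ball N t, ∏ j, x ^ (v j).natAbs := by
          refine Finset.sum_le_sum fun v hv => ?_
          rw [Finset.prod_pow_eq_pow_sum]
          exact pow_le_pow_of_le_one hx0.le (by linarith) (mem_intL1Ball.mp hv)
      _ ≤ ∑ v ∈ Fintype.piFinset fun _ : Fin N => Finset.Icc (-(t : ℤ)) t,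
            ∏ j, x ^ (v j).natAbs :=
          Finset.sum_le_sum_of_subset_of_nonneg (Finset.filter_subset _ _)
            fun _ _ _ => by positivity
      _ = (∑ k ∈ Finset.Icc (-(t : ℤ)) t, x ^ k.natAbs) ^ N := by
          rw [← Finset.prod_univ_sum (fun _ : Fin N => Finset.Icc (-(t : ℤ)) t)
            (fun _ k => x ^ k.natAbs)]
          simp
      _ ≤ (1 + 4 * x) ^ N := by
          gcongr
          exact sum_pow_natAbs_Icc_le t x hx0.le hx2
  have h2 : (1 + 4 * x) ^ N ≤ Real.exp (2 * t) := by
    calc (1 + 4 * x) ^ N ≤ Real.exp (4 * x) ^ N := by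
          gcongr
          linarith [Real.add_one_le_exp (4 * x)]
      _ = Real.exp (2 * t) := by
          rw [← Real.exp_nat_mul, hx]
          congr 1
          field_simp
          ring
  have h3 : x ^ t = Real.exp (-(t * Real.log (2 * (N / t)))) := by
    have : x = Real.exp (-Real.log (2 * (N / t))) := by
      rw [← Real.log_inv, Real.exp_log (by positivity), hx]
      field_simp
    rw [this, ← Real.exp_nat_mul]
    ring_nf
  have h4 : ((intL1Ball N t).card : ℝ) ≤ Real.exp (2 * t + t * Real.log (2 * (N / t))) := by
    rw [h3, Real.exp_neg, ← div_eq_mul_inv, div_le_iff₀ (Real.exp_pos _), ] at h1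
    rw [Real.exp_add]
    exact h1.trans (by gcongr)
  refine h4.trans (Real.exp_le_exp.mpr ?_)
  have e : (t : ℝ) ^ (1 - 1 / q) * (N : ℝ) ^ (1 / q) = t * ((N / t : ℝ)) ^ (1 / q) := by
    rw [Real.div_rpow hN0.le ht0.le, Real.rpow_sub ht0, Real.rpow_one]
    ring
  rw [e]
  set u : ℝ := (N : ℝ) / t with hu
  have hu1 : 1 ≤ u := by rw [hu, one_le_div ht0]; exact htN'
  have hupow : 1 ≤ u ^ (1 / q) := Real.one_le_rpow hu1 (by positivity)
  have hlog : Real.log (2 * u) ≤ 2 * q * u ^ (1 / q) := by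
    have := Real.log_le_rpow_div (x := 2 * u) (by linarith) (ε := 1 / q) (by positivity)
    refine this.trans ?_
    rw [Real.mul_rpow (by norm_num) (by linarith), div_div_eq_mul_div, div_one]
    have h2q : (2 : ℝ) ^ (1 / q) ≤ 2 := by
      calc (2 : ℝ) ^ (1 / q) ≤ 2 ^ (1 : ℝ) :=
            Real.rpow_le_rpow_of_exponent_le (by norm_num) (by
              rw [div_le_one (by linarith)]; linarith)
        _ = 2 := Real.rpow_one 2
    have : (2 : ℝ) ^ (1 / q) * u ^ (1 / q) * q ≤ 2 * u ^ (1 / q) * q := by gcongr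
    linarith
  nlinarith

lemma sum_exp_sub_signMatrix_sq_le {N : ℕ} (m : ℕ) (y : Fin N → ℝ) (hy : 0 < ∑ j, y j ^ 2)
    (b : ℝ) :
    ∑ A : Fin m → Fin N → Bool,
      Real.exp (b - (∑ i, signSum y (A i) ^ 2) / (3 * ∑ j, y j ^ 2)) ≤
      Real.exp b * (5 / 6) ^ m * (2 ^ N) ^ m := by
  have h1 : ∀ A : Fin m → Fin N → Bool,
      Real.exp (b - (∑ i, signSum y (A i) ^ 2) / (3 * ∑ j, y j ^ 2)) = Real.exp b *
        Real.exp (∑ i, -(signSum y (A i) ^ 2 / (3 * ∑ j, y j ^ 2))) := by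
    intro A
    rw [← Real.exp_add, Finset.sum_neg_distrib, ← Finset.sum_div, sub_eq_add_neg]
  simp only [h1]
  rw [← Finset.mul_sum, sum_exp_sum_rows m
    (fun ε => -(signSum y ε ^ 2 / (3 * ∑ j, y j ^ 2))), mul_assoc, ← mul_pow]
  gcongr
  exact sum_exp_neg_signSum_sq_le y hy

lemma sum_exp_signMatrix_sq_sub_le {N : ℕ} (m : ℕ) (y : Fin N → ℝ) (hy : 0 < ∑ j, y j ^ 2)
    (b : ℝ) :
    ∑ A : Fin m → Fin N → Bool,
      Real.exp ((∑ i, signSum y (A i) ^ 2) / (4 * ∑ j, y j ^ 2) - b) ≤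
      Real.exp (m / 2 - b) * (2 ^ N) ^ m := by
  have h1 : ∀ A : Fin m → Fin N → Bool,
      Real.exp ((∑ i, signSum y (A i) ^ 2) / (4 * ∑ j, y j ^ 2) - b) = Real.exp (-b) *
        Real.exp (∑ i, signSum y (A i) ^ 2 / (4 * ∑ j, y j ^ 2)) := by
    intro A
    rw [← Real.exp_add, ← Finset.sum_div, sub_eq_add_neg, add_comm]
  have h2 : Real.exp (m / 2 - b) * ((2 : ℝ) ^ N) ^ m =
      Real.exp (-b) * (Real.exp (1 / 2) * 2 ^ N) ^ m := by
    rw [mul_pow, ← Real.exp_nat_mul, ← mul_assoc, ← Real.exp_add]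
    ring_nf
  simp only [h1]
  rw [← Finset.mul_sum, sum_exp_sum_rows m
    (fun ε => signSum y ε ^ 2 / (4 * ∑ j, y j ^ 2)), h2]
  gcongr
  exact sum_exp_signSum_sq_le y hy

/-- A sign matrix that is bounded below on short integer vectors and bounded above on all
integer vectors of `ℓ_1`-norm at most `N`. -/
lemma exists_sign_matrix {q : ℝ} (hq : 2 < q) {N m : ℕ} (hm : 1 ≤ m) (hmN : m ≤ N) {M : ℝ}
    (hM0 : 0 ≤ M) (hMN : M ≤ N)
    (hM : 22 * (2 + 2 * q) * (M ^ (1 - 1 / q) * (N : ℝ) ^ (1 / q)) ≤ m) :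
    ∃ A : Fin m → Fin N → Bool,
      (∀ v : Fin N → ℤ, v ≠ 0 → ∑ j, (v j).natAbs ≤ ⌊M⌋₊ →
        3 / 22 * m * ∑ j, (v j : ℝ) ^ 2 ≤ ∑ i, signSum (fun j => (v j : ℝ)) (A i) ^ 2) ∧
      ∀ t : ℕ, t ≤ N → ∀ v : Fin N → ℤ, v ≠ 0 → ∑ j, (v j).natAbs ≤ t →
        ∑ i, signSum (fun j => (v j : ℝ)) (A i) ^ 2 ≤
          4 * (∑ j, (v j : ℝ) ^ 2) * (m / 2 +
            (2 + 2 * q) * ((t : ℝ) ^ (1 - 1 / q) * (N : ℝ) ^ (1 / q)) + Real.log (13 * N)) := by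
  have hN0 : (0 : ℝ) < N := by exact_mod_cast hm.trans hmN
  have hm1 : (1 : ℝ) ≤ m := by exact_mod_cast hm
  set Q : (Fin m → Fin N → Bool) → (Fin N → ℤ) → ℝ :=
    fun A v => ∑ i, signSum (fun j => (v j : ℝ)) (A i) ^ 2 with hQ
  set S : (Fin N → ℤ) → ℝ := fun v => ∑ j, (v j : ℝ) ^ 2 with hS
  set K : ℕ → ℝ := fun t => m / 2 +
    (2 + 2 * q) * ((t : ℝ) ^ (1 - 1 / q) * (N : ℝ) ^ (1 / q)) + Real.log (13 * N) with hK
  have hSpos : ∀ v : Fin N → ℤ, v ≠ 0 → 0 < S v := by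
    intro v hv
    obtain ⟨j, hj⟩ := Function.ne_iff.mp hv
    refine Finset.sum_pos' (fun _ _ => by positivity) ⟨j, Finset.mem_univ j, ?_⟩
    have : (v j : ℝ) ≠ 0 := by exact_mod_cast hj
    positivity
  have hlow : ∀ v : Fin N → ℤ, v ≠ 0 →
      ∑ A, Real.exp (m / 22 - Q A v / (3 * S v)) ≤
        Real.exp (m / 22) * (5 / 6) ^ m * (2 ^ N) ^ m :=
    fun v hv => sum_exp_sub_signMatrix_sq_le m _ (hSpos v hv) _
  have hup : ∀ (t : ℕ) (v : Fin N → ℤ), v ≠ 0 →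
      ∑ A, Real.exp (Q A v / (4 * S v) - K t) ≤ Real.exp (m / 2 - K t) * (2 ^ N) ^ m :=
    fun t v hv => sum_exp_signMatrix_sq_sub_le m _ (hSpos v hv) _
  set Y : Finset (Fin N → ℤ) := (intL1Ball N ⌊M⌋₊).erase 0 with hY
  have hYcard : (Y.card : ℝ) ≤ Real.exp (m / 22) := by
    rcases Nat.eq_zero_or_pos ⌊M⌋₊ with h0 | hpos
    · have : Y = ∅ := by
        rw [hY, Finset.erase_eq_empty_iff]
        right
        ext v
        simp [mem_intL1Ball, h0, funext_iff]
      rw [this]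
      simp [Real.exp_nonneg]
    · have hfl : (⌊M⌋₊ : ℝ) ≤ M := Nat.floor_le hM0
      have hflN : ⌊M⌋₊ ≤ N := by exact_mod_cast hfl.trans hMN
      have hc : Y.card ≤ (intL1Ball N ⌊M⌋₊).card := Finset.card_le_card (Finset.erase_subset _ _)
      calc (Y.card : ℝ) ≤ (intL1Ball N ⌊M⌋₊).card := by exact_mod_cast hc
        _ ≤ _ := card_intL1Ball_le hpos hflN hq
        _ ≤ Real.exp (m / 22) := by
          rw [Real.exp_le_exp]
          have hexp : 0 ≤ 1 - 1 / q := by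
            rw [sub_nonneg, div_le_one (by linarith)]; linarith
          have : (⌊M⌋₊ : ℝ) ^ (1 - 1 / q) ≤ M ^ (1 - 1 / q) :=
            Real.rpow_le_rpow (by positivity) hfl hexp
          have : (2 + 2 * q) * ((⌊M⌋₊ : ℝ) ^ (1 - 1 / q) * (N : ℝ) ^ (1 / q)) ≤
              (2 + 2 * q) * (M ^ (1 - 1 / q) * (N : ℝ) ^ (1 / q)) := by gcongr
          linarith
  set F : (Fin m → Fin N → Bool) → ℝ := fun A =>
    ∑ v ∈ Y, Real.exp (m / 22 - Q A v / (3 * S v)) +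
      ∑ t ∈ Finset.Icc 1 N, ∑ v ∈ (intL1Ball N t).erase 0,
        Real.exp (Q A v / (4 * S v) - K t) with hF
  have hsum1 : ∑ A, ∑ v ∈ Y, Real.exp (m / 22 - Q A v / (3 * S v)) ≤
      11 / 12 * (2 ^ N) ^ m := by
    rw [Finset.sum_comm]
    calc ∑ v ∈ Y, ∑ A, Real.exp (m / 22 - Q A v / (3 * S v))
        ≤ ∑ v ∈ Y, Real.exp (m / 22) * (5 / 6) ^ m * (2 ^ N) ^ m :=
          Finset.sum_le_sum fun v hv => hlow v (Finset.ne_of_mem_erase hv)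
      _ = Y.card * (Real.exp (m / 22) * (5 / 6) ^ m * (2 ^ N) ^ m) := by simp
      _ ≤ Real.exp (m / 22) * (Real.exp (m / 22) * (5 / 6) ^ m * (2 ^ N) ^ m) := by gcongr
      _ = (Real.exp (1 / 11) * (5 / 6)) ^ m * (2 ^ N) ^ m := by
          rw [mul_pow, ← Real.exp_nat_mul, ← mul_assoc, ← mul_assoc, ← Real.exp_add]
          ring_nf
      _ ≤ 11 / 12 * (2 ^ N) ^ m := by
          gcongr
          have he : Real.exp (1 / 11) ≤ 11 / 10 := by
            have := Real.one_sub_le_exp_neg (1 / 11)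
            rw [Real.exp_neg, le_inv_comm₀ (by norm_num) (Real.exp_pos _)] at this
            norm_num at this ⊢
            exact this
          calc (Real.exp (1 / 11) * (5 / 6)) ^ m ≤ (11 / 12 : ℝ) ^ m := by
                gcongr
                linarith
            _ ≤ (11 / 12 : ℝ) ^ 1 := pow_le_pow_of_le_one (by norm_num) (by norm_num) hm
            _ = 11 / 12 := pow_one _
  have hsum2 : ∑ A, ∑ t ∈ Finset.Icc 1 N, ∑ v ∈ (intL1Ball N t).erase 0,
      Real.exp (Q A v / (4 * S v) - K t) ≤ 1 / 13 * (2 ^ N) ^ m := by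
    rw [Finset.sum_comm]
    have hterm : ∀ t ∈ Finset.Icc 1 N, ∑ A, ∑ v ∈ (intL1Ball N t).erase 0,
        Real.exp (Q A v / (4 * S v) - K t) ≤ 1 / (13 * N) * (2 ^ N) ^ m := by
      intro t ht
      rw [Finset.mem_Icc] at ht
      rw [Finset.sum_comm]
      have hc : ((intL1Ball N t).erase 0).card ≤ (intL1Ball N t).card :=
        Finset.card_le_card (Finset.erase_subset _ _)
      calc ∑ v ∈ (intL1Ball N t).erase 0, ∑ A, Real.exp (Q A v / (4 * S v) - K t)
          ≤ ∑ v ∈ (intL1Ball N t).erase 0, Real.exp (m / 2 - K t) * (2 ^ N) ^ m :=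
            Finset.sum_le_sum fun v hv => hup t v (Finset.ne_of_mem_erase hv)
        _ = ((intL1Ball N t).erase 0).card * (Real.exp (m / 2 - K t) * (2 ^ N) ^ m) := by simp
        _ ≤ (intL1Ball N t).card * (Real.exp (m / 2 - K t) * (2 ^ N) ^ m) := by
            gcongr
        _ ≤ Real.exp ((2 + 2 * q) * ((t : ℝ) ^ (1 - 1 / q) * (N : ℝ) ^ (1 / q))) *
              (Real.exp (m / 2 - K t) * (2 ^ N) ^ m) := by
            gcongr
            exact card_intL1Ball_le ht.1 ht.2 hq
        _ = Real.exp (-Real.log (13 * N)) * (2 ^ N) ^ m := by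
            rw [← mul_assoc, ← Real.exp_add, hK]
            ring_nf
        _ = 1 / (13 * N) * (2 ^ N) ^ m := by
            rw [Real.exp_neg, Real.exp_log (by positivity), one_div]
    refine (Finset.sum_le_sum hterm).trans (le_of_eq ?_)
    simp only [Finset.sum_const, Nat.card_Icc, nsmul_eq_mul, Nat.add_sub_cancel]
    field_simp
  obtain ⟨A, -, hA⟩ : ∃ A ∈ (Finset.univ : Finset (Fin m → Fin N → Bool)), F A < 1 := by
    refine Finset.exists_lt_of_sum_lt ?_
    rw [hF, Finset.sum_add_distrib]
    have hcard : ∑ _A : Fin m → Fin N → Bool, (1 : ℝ) = (2 ^ N) ^ m := by simp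
    rw [hcard]
    have : (0 : ℝ) < (2 ^ N) ^ m := by positivity
    linarith
  have hF1 : ∑ v ∈ Y, Real.exp (m / 22 - Q A v / (3 * S v)) < 1 :=
    lt_of_le_of_lt (le_add_of_nonneg_right (Finset.sum_nonneg fun _ _ =>
      Finset.sum_nonneg fun _ _ => Real.exp_nonneg _)) hA
  have hF2 : ∑ t ∈ Finset.Icc 1 N, ∑ v ∈ (intL1Ball N t).erase 0,
      Real.exp (Q A v / (4 * S v) - K t) < 1 :=
    lt_of_le_of_lt (le_add_of_nonneg_left (Finset.sum_nonneg fun _ _ =>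
      Real.exp_nonneg _)) hA
  refine ⟨A, fun v hv hvM => ?_, fun t ht v hv hvt => ?_⟩
  · have h1 := (Finset.single_le_sum (f := fun v => Real.exp (m / 22 - Q A v / (3 * S v)))
      (fun _ _ => Real.exp_nonneg _)
      (Finset.mem_erase.mpr ⟨hv, mem_intL1Ball.mpr hvM⟩)).trans_lt hF1
    rw [Real.exp_lt_one_iff, sub_neg, lt_div_iff₀ (by have := hSpos v hv; positivity)] at h1
    change 3 / 22 * m * S v ≤ Q A v
    linarith
  · have ht1 : 1 ≤ t := by
      by_contra h0
      have : t = 0 := by omega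
      subst this
      apply hv
      ext j
      simpa using Finset.sum_eq_zero_iff.mp (Nat.le_zero.mp hvt) j (Finset.mem_univ j)
    have h0 : ∀ t ∈ Finset.Icc 1 N, 0 ≤ ∑ v ∈ (intL1Ball N t).erase 0,
      Real.exp (Q A v / (4 * S v) - K t) :=
        fun _ _ => Finset.sum_nonneg fun _ _ => Real.exp_nonneg _
    have h1 := (Finset.single_le_sum h0 (Finset.mem_Icc.mpr ⟨ht1, ht⟩)).trans_lt hF2
    have h2 := (Finset.single_le_sum (f := fun v => Real.exp (Q A v / (4 * S v) - K t))
      (fun _ _ => Real.exp_nonneg _)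
      (Finset.mem_erase.mpr ⟨hv, mem_intL1Ball.mpr hvt⟩)).trans_lt h1
    rw [Real.exp_lt_one_iff, sub_neg, div_lt_iff₀ (by have := hSpos v hv; positivity)] at h2
    change Q A v ≤ 4 * S v * K t
    linarith

/-- Layer decomposition: a seminorm controlled on `{-1, 0, 1}`-vectors is controlled by
the decreasing rearrangement. -/
lemma seminorm_le_sum_rearrangement {N : ℕ} (G : Seminorm ℝ (Fin N → ℝ)) (a : ℕ → ℝ)
    (ha : ∀ k, 0 ≤ a k)
    (hG : ∀ w : Fin N → ℤ, (∀ j, (w j).natAbs ≤ 1) →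
      G (fun j => (w j : ℝ)) ≤ ∑ i ∈ Finset.range (∑ j, (w j).natAbs), a i)
    (z : Fin N → ℝ) :
    ∃ σ : Equiv.Perm (Fin N), Antitone (fun k => |z (σ k)|) ∧
      G z ≤ ∑ k : Fin N, |z (σ k)| * a k := by
  set σ := Tuple.sort (fun j => -|z j|) with hσ
  have hanti : Antitone (fun k => |z (σ k)|) := by
    intro i j hij
    have := Tuple.monotone_sort (fun j => -|z j|) hij
    simpa using this
  refine ⟨σ, hanti, ?_⟩
  set f : ℕ → ℝ := fun k => if h : k < N then |z (σ ⟨k, h⟩)| else 0 with hf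
  have hf_nonneg : ∀ k, 0 ≤ f k := by
    intro k
    simp only [hf]
    split_ifs <;> positivity
  have hf_anti : ∀ k, f (k + 1) ≤ f k := by
    intro k
    by_cases h : k + 1 < N
    · have h' : k < N := by omega
      simp only [hf, h, h', dif_pos]
      exact hanti (by simp [Fin.le_def])
    · simp only [hf, h, dif_neg, not_false_eq_true]
      split_ifs <;> positivity
  set w : ℕ → Fin N → ℤ := fun k j =>
    if (σ.symm j : ℕ) < k then (SignType.sign (z j) : ℤ) else 0 with hw
  set v : ℕ → Fin N → ℝ := fun k j =>
    if (σ.symm j : ℕ) < k then (|z j| - f k) * (SignType.sign (z j) : ℝ) else 0 with hv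
  have hsign : ∀ x : ℝ, ((SignType.sign x : SignType) : ℤ).natAbs ≤ 1 := by
    intro x
    rcases lt_trichotomy x 0 with h | h | h <;> simp [h]
  have hw1 : ∀ k j, (w k j).natAbs ≤ if (σ.symm j : ℕ) < k then 1 else 0 := by
    intro k j
    simp only [hw]
    split_ifs
    · exact hsign _
    · simp
  have hwcard : ∀ k, ∑ j, (w k j).natAbs ≤ k := by
    intro k
    calc ∑ j, (w k j).natAbs ≤ ∑ j, if (σ.symm j : ℕ) < k then 1 else 0 :=
          Finset.sum_le_sum fun j _ => hw1 k j
      _ = ∑ j : Fin N, if (j : ℕ) < k then 1 else 0 :=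
          σ.symm.sum_comp (fun j : Fin N => if (j : ℕ) < k then 1 else 0)
      _ = ∑ j ∈ Finset.range N, if j < k then 1 else 0 :=
          Fin.sum_univ_eq_sum_range (fun j => if j < k then 1 else 0) N
      _ ≤ k := by
          rw [← Finset.sum_filter, Finset.sum_const, smul_eq_mul, mul_one]
          calc _ ≤ (Finset.range k).card := Finset.card_le_card fun j hj => by
                simp only [Finset.mem_filter, Finset.mem_range] at hj ⊢
                exact hj.2
            _ = k := Finset.card_range k
  have hGw : ∀ k, G (fun j => (w k j : ℝ)) ≤ ∑ i ∈ Finset.range k, a i := by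
    intro k
    refine (hG (w k) fun j => (hw1 k j).trans (by split_ifs <;> simp)).trans ?_
    exact Finset.sum_le_sum_of_subset_of_nonneg
      (Finset.range_subset_range.mpr (hwcard k)) fun _ _ _ => ha _
  have hstep : ∀ k, v (k + 1) = v k + (f k - f (k + 1)) • fun j => (w (k + 1) j : ℝ) := by
    intro k
    ext j
    simp only [hv, hw, Pi.add_apply, Pi.smul_apply, smul_eq_mul]
    rcases lt_trichotomy (σ.symm j : ℕ) k with h | h | h
    · have hsucc : (σ.symm j : ℕ) < k + 1 := by omega
      simp only [h, hsucc, if_true]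
      push_cast
      ring
    · have hsucc : (σ.symm j : ℕ) < k + 1 := by omega
      have hlt : ¬ (σ.symm j : ℕ) < k := by omega
      have hfk : f k = |z j| := by
        have hk : k < N := h ▸ (σ.symm j).isLt
        simp only [hf, hk, dif_pos]
        have : (⟨k, hk⟩ : Fin N) = σ.symm j := Fin.ext h.symm
        rw [this, Equiv.apply_symm_apply]
      simp only [hsucc, hlt, if_true, if_false, hfk]
      push_cast
      ring
    · have hsucc : ¬ (σ.symm j : ℕ) < k + 1 := by omega
      have hlt : ¬ (σ.symm j : ℕ) < k := by omega
      simp [hsucc, hlt]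
  have hind : ∀ k, G (v k) + f k * ∑ i ∈ Finset.range k, a i ≤
      ∑ i ∈ Finset.range k, f i * a i := by
    intro k
    induction k with
    | zero =>
      have : v 0 = 0 := by ext j; simp [hv]
      simp [this]
    | succ k ih =>
      have h1 : G (v (k + 1)) ≤ G (v k) + (f k - f (k + 1)) * ∑ i ∈ Finset.range (k + 1), a i := by
        rw [hstep k]
        refine (map_add_le_add G _ _).trans ?_
        rw [map_smul_eq_mul, Real.norm_of_nonneg (sub_nonneg.mpr (hf_anti k))]
        have := mul_le_mul_of_nonneg_left (hGw (k + 1)) (sub_nonneg.mpr (hf_anti k))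
        linarith
      rw [Finset.sum_range_succ] at h1 ⊢
      rw [Finset.sum_range_succ (fun i => f i * a i)]
      linarith
  have hvN : v N = z := by
    ext j
    simp only [hv, hf, (σ.symm j).isLt, if_true, lt_irrefl, dif_neg, not_false_eq_true, sub_zero]
    rw [mul_comm]
    exact sign_mul_abs (z j)
  have hfin := hind N
  rw [hvN] at hfin
  have hfN : f N = 0 := by simp [hf]
  rw [hfN, zero_mul, add_zero] at hfin
  refine hfin.trans (le_of_eq ?_)
  rw [← Fin.sum_univ_eq_sum_range (fun i => f i * a i) N]
  exact Finset.sum_congr rfl fun k _ => by simp [hf]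

lemma rpow_one_sub_le_sum (c : ℝ) (hc : 0 ≤ c) (t : ℕ) (ht : 1 ≤ t) :
    (t : ℝ) ^ (1 - c) ≤ ∑ i ∈ Finset.range t, ((i : ℝ) + 1) ^ (-c) := by
  have ht0 : (0 : ℝ) < t := by exact_mod_cast ht
  calc (t : ℝ) ^ (1 - c) = ∑ _i ∈ Finset.range t, (t : ℝ) ^ (-c) := by
        rw [Finset.sum_const, Finset.card_range, nsmul_eq_mul, sub_eq_add_neg,
          Real.rpow_add ht0, Real.rpow_one]
    _ ≤ _ := by
        refine Finset.sum_le_sum fun i hi => ?_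
        rw [Finset.mem_range] at hi
        have : (i : ℝ) + 1 ≤ t := by exact_mod_cast hi
        exact Real.rpow_le_rpow_of_nonpos (by positivity) this (by linarith)

lemma sum_rpow_sub_one_le (c : ℝ) (hc : 0 < c) (hc1 : c ≤ 1) (N : ℕ) :
    ∑ k ∈ Finset.range N, ((k : ℝ) + 1) ^ (c - 1) ≤ (N : ℝ) ^ c / c := by
  induction N with
  | zero => simp [Real.zero_rpow hc.ne']
  | succ k ih =>
    rw [Finset.sum_range_succ]
    push_cast
    have hk : (0 : ℝ) < k + 1 := by positivity
    have h1 : (k : ℝ) ^ c ≤ ((k : ℝ) + 1) ^ c * (1 - c / (k + 1)) := by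
      have hb := rpow_one_add_le_one_add_mul_self (s := -(1 / ((k : ℝ) + 1)))
        (by rw [neg_le_neg_iff, div_le_one hk]; linarith [(Nat.cast_nonneg k : (0 : ℝ) ≤ k)])
        hc.le hc1
      have e : (k : ℝ) ^ c = ((k : ℝ) + 1) ^ c * (1 + -(1 / ((k : ℝ) + 1))) ^ c := by
        rw [← Real.mul_rpow hk.le]
        · congr 1
          field_simp
          ring
        · rw [← sub_eq_add_neg, sub_nonneg, div_le_one hk]
          linarith [(Nat.cast_nonneg k : (0 : ℝ) ≤ k)]
      rw [e]
      refine (mul_le_mul_of_nonneg_left hb (by positivity)).trans (le_of_eq ?_)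
      ring
    have h2 : ((k : ℝ) + 1) ^ (c - 1) = ((k : ℝ) + 1) ^ c / (k + 1) := by
      rw [Real.rpow_sub hk, Real.rpow_one]
    rw [h2]
    rw [le_div_iff₀ hc] at ih ⊢
    have h3 : ((k : ℝ) + 1) ^ c * (1 - c / (k + 1)) =
      ((k : ℝ) + 1) ^ c - ((k : ℝ) + 1) ^ c / (k + 1) * c := by ring
    linarith

lemma exists_int_truncation (x δ : ℝ) (hδ : 0 < δ) :
    ∃ k : ℤ, δ * |(k : ℝ)| ≤ |x| ∧ |x - δ * k| ≤ δ ∧ |x - δ * k| ≤ |x| := by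
  have key : ∀ x : ℝ, 0 ≤ x →
      ∃ k : ℤ, δ * |(k : ℝ)| ≤ |x| ∧ |x - δ * k| ≤ δ ∧ |x - δ * k| ≤ |x| := by
    intro x hx
    have h0 : (0 : ℝ) ≤ (⌊x / δ⌋ : ℝ) := by exact_mod_cast Int.floor_nonneg.mpr (by positivity)
    have h1 : δ * (⌊x / δ⌋ : ℝ) ≤ x := by
      have := Int.floor_le (x / δ)
      rwa [le_div_iff₀ hδ, mul_comm] at this
    have h2 : x ≤ δ * (⌊x / δ⌋ : ℝ) + δ := by
      have := (Int.lt_floor_add_one (x / δ)).le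
      rw [div_le_iff₀ hδ] at this
      linarith
    have h3 : 0 ≤ δ * (⌊x / δ⌋ : ℝ) := by positivity
    refine ⟨⌊x / δ⌋, ?_, ?_, ?_⟩
    · rwa [abs_of_nonneg h0, abs_of_nonneg hx]
    · rw [abs_of_nonneg (by linarith)]; linarith
    · rw [abs_of_nonneg (by linarith), abs_of_nonneg hx]; linarith
  rcases le_total 0 x with hx | hx
  · exact key x hx
  · obtain ⟨k, h1, h2, h3⟩ := key (-x) (by linarith)
    refine ⟨-k, ?_, ?_, ?_⟩
    · push_cast; rwa [abs_neg, ← abs_neg x]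
    · push_cast; rw [← abs_neg]; convert h2 using 2; ring
    · push_cast; rw [← abs_neg, ← abs_neg x]; convert h3 using 2; ring

lemma signSum_add {N : ℕ} (y z : Fin N → ℝ) (ε : Fin N → Bool) :
    signSum (y + z) ε = signSum y ε + signSum z ε := by
  simp [signSum, mul_add, Finset.sum_add_distrib]

lemma signSum_smul {N : ℕ} (r : ℝ) (y : Fin N → ℝ) (ε : Fin N → Bool) :
    signSum (r • y) ε = r * signSum y ε := by
  simp only [signSum, Pi.smul_apply, smul_eq_mul, Finset.mul_sum]
  exact Finset.sum_congr rfl fun j _ => by ring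

/-- The seminorm `z ↦ ‖A z‖_2` of a sign matrix `A`. -/
noncomputable def signSeminorm {N m : ℕ} (A : Fin m → Fin N → Bool) : Seminorm ℝ (Fin N → ℝ) :=
  (normSeminorm ℝ (EuclideanSpace ℝ (Fin m))).comp
    ({ toFun := fun z => WithLp.toLp 2 fun i => signSum z (A i)
       map_add' := fun y z => by ext i; simp [signSum_add]
       map_smul' := fun r y => by ext i; simp [signSum_smul] } :
      (Fin N → ℝ) →ₗ[ℝ] EuclideanSpace ℝ (Fin m))

lemma signSeminorm_sq {N m : ℕ} (A : Fin m → Fin N → Bool) (z : Fin N → ℝ) :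
    signSeminorm A z ^ 2 = ∑ i, signSum z (A i) ^ 2 := by
  simp [signSeminorm, EuclideanSpace.norm_sq_eq]

/-- The weights dominating the increments of `signSeminorm` over layers. -/
noncomputable def layerWeight (q M : ℝ) (k : ℕ) : ℝ :=
  (if k = 0 then M ^ (1 - 1 / (2 * q)) else 0) + ((k : ℝ) + 1) ^ (-(1 / (2 * q)))

lemma layerWeight_nonneg {q M : ℝ} (hM : 0 ≤ M) (k : ℕ) : 0 ≤ layerWeight q M k := by
  unfold layerWeight
  split_ifs <;> positivity

lemma rpow_max_le_sum_layerWeight {q M : ℝ} (hq : 2 < q) (hM : 0 ≤ M) {t : ℕ} (ht : 1 ≤ t) :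
    (max M t) ^ (1 - 1 / (2 * q)) ≤ ∑ i ∈ Finset.range t, layerWeight q M i := by
  unfold layerWeight
  rw [Finset.sum_add_distrib, Finset.sum_ite_eq' (Finset.range t) 0,
    if_pos (Finset.mem_range.mpr ht)]
  have h1 := rpow_one_sub_le_sum (1 / (2 * q)) (by positivity) t ht
  have h2 : 0 ≤ M ^ (1 - 1 / (2 * q)) := by positivity
  have h3 : 0 ≤ (t : ℝ) ^ (1 - 1 / (2 * q)) := by positivity
  rcases max_choice M (t : ℝ) with h | h <;> rw [h] <;> linarith

lemma signSeminorm_le_sum_layerWeight {q : ℝ} (hq : 2 < q) {N m : ℕ} (hN : 1 ≤ N) {M : ℝ}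
    (hM0 : 0 < M)
    (hM : 22 * (2 + 2 * q) * (M ^ (1 - 1 / q) * (N : ℝ) ^ (1 / q)) = m)
    (A : Fin m → Fin N → Bool)
    (hA : ∀ t : ℕ, t ≤ N → ∀ v : Fin N → ℤ, v ≠ 0 → ∑ j, (v j).natAbs ≤ t →
        ∑ i, signSum (fun j => (v j : ℝ)) (A i) ^ 2 ≤
          4 * (∑ j, (v j : ℝ) ^ 2) * (m / 2 +
            (2 + 2 * q) * ((t : ℝ) ^ (1 - 1 / q) * (N : ℝ) ^ (1 / q)) + Real.log (13 * N)))
    (w : Fin N → ℤ) (hw : ∀ j, (w j).natAbs ≤ 1) :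
    signSeminorm A (fun j => (w j : ℝ)) ≤
      ∑ i ∈ Finset.range (∑ j, (w j).natAbs),
        2 * √(12 * (2 + 2 * q) + 13 * q) * (N : ℝ) ^ (1 / (2 * q)) * layerWeight q M i := by
  rw [← Finset.mul_sum]
  set E := 12 * (2 + 2 * q) + 13 * q with hE
  have hE0 : 0 ≤ E := by rw [hE]; linarith
  have hN1 : (1 : ℝ) ≤ N := by exact_mod_cast hN
  have hN0 : (0 : ℝ) < N := by linarith
  by_cases hw0 : w = 0
  · subst hw0
    have : (fun j : Fin N => (((0 : Fin N → ℤ) j : ℤ) : ℝ)) = 0 := by ext; simp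
    rw [this, map_zero]
    simp
  set t := ∑ j, (w j).natAbs with ht
  have ht1 : 1 ≤ t := by
    by_contra h0
    have h0 : t = 0 := by omega
    apply hw0
    ext j
    simpa using Finset.sum_eq_zero_iff.mp h0 j (Finset.mem_univ j)
  have htN : t ≤ N := by
    calc t ≤ ∑ _j : Fin N, 1 := Finset.sum_le_sum fun j _ => hw j
      _ = N := by simp
  have hS : ∑ j, (w j : ℝ) ^ 2 = t := by
    rw [ht]
    push_cast
    refine Finset.sum_congr rfl fun j _ => ?_
    have : (w j).natAbs = 0 ∨ (w j).natAbs = 1 := by have := hw j; omega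
    rcases this with h | h
    · rw [Int.natAbs_eq_zero] at h; simp [h]
    · rcases Int.natAbs_eq_iff.mp h with h | h <;> simp [h]
  have h1 := hA t htN w hw0 le_rfl
  rw [hS, ← signSeminorm_sq] at h1
  set R := max M t with hR
  have hR1 : 1 ≤ R := le_max_of_le_right (by exact_mod_cast ht1)
  have hR0 : 0 < R := by linarith
  have hexp : 0 ≤ 1 - 1 / q := by
    rw [sub_nonneg, div_le_one (by linarith)]; linarith
  set P := R ^ (1 - 1 / q) * (N : ℝ) ^ (1 / q) with hP
  have hP0 : 0 ≤ P := by positivity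
  have hMP : M ^ (1 - 1 / q) * (N : ℝ) ^ (1 / q) ≤ P := by
    rw [hP]
    gcongr
    exact le_max_left _ _
  have htP : (t : ℝ) ^ (1 - 1 / q) * (N : ℝ) ^ (1 / q) ≤ P := by
    rw [hP]
    gcongr
    exact le_max_right _ _
  have hlog : Real.log (13 * N) ≤ 13 * q * P := by
    have h := Real.log_le_rpow_div (x := 13 * (N : ℝ)) (by positivity) (ε := 1 / q) (by positivity)
    refine h.trans ?_
    rw [Real.mul_rpow (by norm_num) hN0.le, div_div_eq_mul_div, div_one]
    have h13 : (13 : ℝ) ^ (1 / q) ≤ 13 := by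
      calc (13 : ℝ) ^ (1 / q) ≤ 13 ^ (1 : ℝ) :=
            Real.rpow_le_rpow_of_exponent_le (by norm_num) (by
              rw [div_le_one (by linarith)]; linarith)
        _ = 13 := Real.rpow_one 13
    have hNP : (N : ℝ) ^ (1 / q) ≤ P :=
      le_mul_of_one_le_left (by positivity) (Real.one_le_rpow hR1 hexp)
    have : (13 : ℝ) ^ (1 / q) * (N : ℝ) ^ (1 / q) * q ≤ 13 * P * q := by gcongr
    linarith
  have hK : (m : ℝ) / 2 + (2 + 2 * q) * ((t : ℝ) ^ (1 - 1 / q) * (N : ℝ) ^ (1 / q)) +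
      Real.log (13 * N) ≤ E * P := by
    have e1 : (2 + 2 * q) * (M ^ (1 - 1 / q) * (N : ℝ) ^ (1 / q)) ≤ (2 + 2 * q) * P := by gcongr
    have e2 : (2 + 2 * q) * ((t : ℝ) ^ (1 - 1 / q) * (N : ℝ) ^ (1 / q)) ≤ (2 + 2 * q) * P := by
      gcongr
    rw [hE]
    linarith
  have hsq : signSeminorm A (fun j => (w j : ℝ)) ^ 2 ≤
      (2 * √E * (N : ℝ) ^ (1 / (2 * q)) * R ^ (1 - 1 / (2 * q))) ^ 2 := by
    have e1 : ((N : ℝ) ^ (1 / (2 * q))) ^ 2 = (N : ℝ) ^ (1 / q) := by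
      rw [← Real.rpow_natCast, ← Real.rpow_mul hN0.le]
      congr 1
      field_simp
      norm_num
    have e2 : (R ^ (1 - 1 / (2 * q))) ^ 2 = R * R ^ (1 - 1 / q) := by
      rw [← Real.rpow_natCast, ← Real.rpow_mul hR0.le]
      nth_rewrite 2 [← Real.rpow_one R]
      rw [← Real.rpow_add hR0]
      congr 1
      field_simp
      push_cast
      ring
    rw [mul_pow, mul_pow, mul_pow, Real.sq_sqrt hE0, e1, e2]
    calc _ ≤ _ := h1
      _ ≤ 4 * t * (E * P) := by gcongr
      _ ≤ 4 * R * (E * P) := by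
          gcongr
          exact le_max_right M (t : ℝ)
      _ = _ := by rw [hP]; ring
  refine (le_of_abs_le (abs_le_of_sq_le_sq hsq (by positivity))).trans ?_
  gcongr
  exact rpow_max_le_sum_layerWeight hq hM0.le ht1

lemma seminorm_le_of_layerWeight {p q : ℝ} (hq : 2 < q) (hp : 0 < p) (hpq : 1 / p = 1 - 1 / q)
    {N : ℕ} {M B : ℝ} (hM0 : 0 < M) (hMN : M ≤ N) (hB : 0 ≤ B)
    (G : Seminorm ℝ (Fin N → ℝ))
    (hG : ∀ w : Fin N → ℤ, (∀ j, (w j).natAbs ≤ 1) →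
      G (fun j => (w j : ℝ)) ≤ ∑ i ∈ Finset.range (∑ j, (w j).natAbs), B * layerWeight q M i)
    (z : Fin N → ℝ) (hz : ∀ j, |z j| ≤ M ^ (-(1 - 1 / q))) (hzp : ∑ j, |z j| ^ p ≤ 1) :
    G z ≤ B * ((1 + 2 * q) * (N : ℝ) ^ (1 / (2 * q))) := by
  obtain ⟨σ, hσ, hGz⟩ := seminorm_le_sum_rearrangement G (fun k => B * layerWeight q M k)
    (fun k => mul_nonneg hB (layerWeight_nonneg hM0.le k)) hG z
  have hdecay : ∀ k : Fin N, |z (σ k)| ≤ ((k : ℝ) + 1) ^ (-(1 - 1 / q)) := by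
    intro k
    have h1 : ((k : ℝ) + 1) * |z (σ k)| ^ p ≤ 1 := by
      calc ((k : ℝ) + 1) * |z (σ k)| ^ p = ∑ _i ∈ Finset.Iic k, |z (σ k)| ^ p := by simp
        _ ≤ ∑ i ∈ Finset.Iic k, |z (σ i)| ^ p := by
            refine Finset.sum_le_sum fun i hi => ?_
            exact Real.rpow_le_rpow (abs_nonneg _) (hσ (Finset.mem_Iic.mp hi)) hp.le
        _ ≤ ∑ i, |z (σ i)| ^ p :=
            Finset.sum_le_sum_of_subset_of_nonneg (Finset.subset_univ _)
              fun _ _ _ => by positivity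
        _ = ∑ i, |z i| ^ p := Equiv.sum_comp σ fun i => |z i| ^ p
        _ ≤ 1 := hzp
    have hk : (0 : ℝ) < k + 1 := by positivity
    have h2 : |z (σ k)| ^ p ≤ ((k : ℝ) + 1)⁻¹ := by
      rwa [← one_div, le_div_iff₀ hk, mul_comm]
    calc |z (σ k)| = (|z (σ k)| ^ p) ^ (1 / p) := by
          rw [← Real.rpow_mul (abs_nonneg _), mul_one_div_cancel hp.ne', Real.rpow_one]
      _ ≤ (((k : ℝ) + 1)⁻¹) ^ (1 / p) := by gcongr
      _ = _ := by rw [hpq, Real.inv_rpow hk.le, Real.rpow_neg hk.le]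
  have hterm : ∀ k : Fin N, |z (σ k)| * (B * layerWeight q M k) ≤
      B * ((if (k : ℕ) = 0 then (N : ℝ) ^ (1 / (2 * q)) else 0) +
        ((k : ℝ) + 1) ^ (1 / (2 * q) - 1)) := by
    intro k
    have hk : (0 : ℝ) < k + 1 := by positivity
    rw [mul_left_comm]
    refine mul_le_mul_of_nonneg_left ?_ hB
    unfold layerWeight
    rw [mul_add]
    refine add_le_add ?_ ?_
    · split_ifs
      · calc |z (σ k)| * M ^ (1 - 1 / (2 * q))
            ≤ M ^ (-(1 - 1 / q)) * M ^ (1 - 1 / (2 * q)) := by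
              gcongr
              exact hz _
          _ = M ^ (1 / (2 * q)) := by
              rw [← Real.rpow_add hM0]
              congr 1
              field_simp
              ring
          _ ≤ (N : ℝ) ^ (1 / (2 * q)) := by gcongr
      · simp
    · calc |z (σ k)| * ((k : ℝ) + 1) ^ (-(1 / (2 * q)))
          ≤ ((k : ℝ) + 1) ^ (-(1 - 1 / q)) * ((k : ℝ) + 1) ^ (-(1 / (2 * q))) := by
            gcongr
            exact hdecay k
        _ = ((k : ℝ) + 1) ^ (1 / (2 * q) - 1) := by
            rw [← Real.rpow_add hk]
            congr 1
            field_simp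
            ring
  refine hGz.trans ((Finset.sum_le_sum fun k _ => hterm k).trans ?_)
  rw [← Finset.mul_sum]
  refine mul_le_mul_of_nonneg_left ?_ hB
  rw [Fin.sum_univ_eq_sum_range (fun k => (if k = 0 then (N : ℝ) ^ (1 / (2 * q)) else 0) +
    ((k : ℝ) + 1) ^ (1 / (2 * q) - 1)) N, Finset.sum_add_distrib, Finset.sum_ite_eq', add_mul]
  refine add_le_add ?_ ?_
  · split_ifs
    · simp
    · positivity
  · have := sum_rpow_sub_one_le (1 / (2 * q)) (by positivity)
      (by rw [div_le_one (by linarith)]; linarith) N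
    rwa [div_div_eq_mul_div, div_one, mul_comm (_ ^ _) (2 * q)] at this

/-- Euclidean size of the section of the `ℓ_p`-ball by the kernel of a suitable matrix. -/
theorem exists_matrix_ker_small {p q : ℝ} (hq : 2 < q) (hp1 : 1 ≤ p) (hp2 : p ≤ 2)
    (hpq : 1 / p = 1 - 1 / q) :
    ∃ C : ℝ, 0 < C ∧ ∀ N m : ℕ, 1 ≤ m → m ≤ N → ∃ A : Fin m → Fin N → ℝ,
      ∀ x : Fin N → ℝ, (∀ i, ∑ j, A i j * x j = 0) → ∑ j, |x j| ^ p ≤ 1 →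
        ∑ j, x j ^ 2 ≤ C * ((N : ℝ) ^ (2 / q) / m) := by
  set D := 2 + 2 * q with hD
  set E := 12 * (2 + 2 * q) + 13 * q with hE
  have hD0 : 0 < D := by rw [hD]; linarith
  have hE0 : 0 < E := by rw [hE]; linarith
  have hp0 : 0 < p := by linarith
  refine ⟨2 * (22 / 3 * (4 * E * (1 + 2 * q) ^ 2)) + 2 * (22 * D), by positivity, ?_⟩
  intro N m hm hmN
  have hm0 : (0 : ℝ) < m := by exact_mod_cast hm
  have hN0 : (0 : ℝ) < N := by exact_mod_cast hm.trans hmN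
  have hmN' : (m : ℝ) ≤ N := by exact_mod_cast hmN
  set M : ℝ := (m / (22 * D) * (N : ℝ) ^ (-(1 / q))) ^ p with hMdef
  have hM0 : 0 < M := by positivity
  have hMp : M ^ (1 - 1 / q) = m / (22 * D) * (N : ℝ) ^ (-(1 / q)) := by
    rw [hMdef, ← hpq, ← Real.rpow_mul (by positivity), mul_one_div_cancel hp0.ne', Real.rpow_one]
  have hM : 22 * D * (M ^ (1 - 1 / q) * (N : ℝ) ^ (1 / q)) = m := by
    rw [hMp, Real.rpow_neg hN0.le]
    have : (0 : ℝ) < (N : ℝ) ^ (1 / q) := by positivity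
    field_simp
  have hMN : M ≤ N := by
    have h1 : m / (22 * D) * (N : ℝ) ^ (-(1 / q)) ≤ (N : ℝ) ^ (1 / p) := by
      rw [hpq, sub_eq_add_neg, Real.rpow_add hN0, Real.rpow_one]
      gcongr
      refine (div_le_self hm0.le ?_).trans hmN'
      rw [hD]; linarith
    calc M ≤ ((N : ℝ) ^ (1 / p)) ^ p := Real.rpow_le_rpow (by positivity) h1 hp0.le
      _ = N := by
        rw [← Real.rpow_mul hN0.le, one_div_mul_cancel hp0.ne', Real.rpow_one]
  obtain ⟨A, hlow, hup⟩ := exists_sign_matrix hq hm hmN hM0.le hMN hM.le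
  refine ⟨fun i j => if A i j then 1 else -1, fun x hx hxp => ?_⟩
  set δ : ℝ := M ^ (-(1 - 1 / q)) with hδ
  have hδ0 : 0 < δ := by positivity
  have hδp : δ ^ p = M⁻¹ := by
    rw [hδ, ← hpq, ← Real.rpow_mul hM0.le, neg_mul, one_div_mul_cancel hp0.ne', Real.rpow_neg_one]
  choose v hv1 hv2 hv3 using fun j => exists_int_truncation (x j) δ hδ0
  set z : Fin N → ℝ := fun j => x j - δ * v j with hz
  have hzp : ∑ j, |z j| ^ p ≤ 1 :=
    (Finset.sum_le_sum fun j _ => Real.rpow_le_rpow (abs_nonneg _) (hv3 j) hp0.le).trans hxp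
  have hvM : ∑ j, (v j).natAbs ≤ ⌊M⌋₊ := by
    refine Nat.le_floor ?_
    push_cast
    have hj : ∀ j, ((v j).natAbs : ℝ) ≤ M * |x j| ^ p := by
      intro j
      rw [Nat.cast_natAbs, Int.cast_abs]
      have h1 : |(v j : ℝ)| ≤ |(v j : ℝ)| ^ p := by
        by_cases h : v j = 0
        · simp [h, Real.zero_rpow hp0.ne']
        · refine Real.self_le_rpow_of_one_le ?_ hp1
          exact_mod_cast Int.one_le_abs h
      have h2 : (δ * |(v j : ℝ)|) ^ p ≤ |x j| ^ p :=
        Real.rpow_le_rpow (by positivity) (hv1 j) hp0.le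
      rw [Real.mul_rpow hδ0.le (abs_nonneg _), hδp, inv_mul_le_iff₀ hM0] at h2
      exact h1.trans h2
    calc ∑ j, ((v j).natAbs : ℝ) ≤ ∑ j, M * |x j| ^ p := Finset.sum_le_sum fun j _ => hj j
      _ = M * ∑ j, |x j| ^ p := by rw [Finset.mul_sum]
      _ ≤ M * 1 := by gcongr
      _ = M := mul_one M
  have hGz := seminorm_le_of_layerWeight hq hp0 hpq hM0 hMN
    (B := 2 * √E * (N : ℝ) ^ (1 / (2 * q))) (by positivity) (signSeminorm A)
    (signSeminorm_le_sum_layerWeight hq (hm.trans hmN) hM0 hM A hup) z hv2 hzp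
  have hGz2 : signSeminorm A z ^ 2 ≤ 4 * E * (1 + 2 * q) ^ 2 * (N : ℝ) ^ (2 / q) := by
    have e : ((N : ℝ) ^ (1 / (2 * q))) ^ 4 = (N : ℝ) ^ (2 / q) := by
      rw [← Real.rpow_natCast, ← Real.rpow_mul hN0.le]
      congr 1
      field_simp
      norm_num
    calc signSeminorm A z ^ 2 ≤ (2 * √E * (N : ℝ) ^ (1 / (2 * q)) *
          ((1 + 2 * q) * (N : ℝ) ^ (1 / (2 * q)))) ^ 2 :=
          pow_le_pow_left₀ (apply_nonneg _ _) hGz 2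
      _ = 4 * √E ^ 2 * (1 + 2 * q) ^ 2 * ((N : ℝ) ^ (1 / (2 * q))) ^ 4 := by ring
      _ = _ := by rw [Real.sq_sqrt hE0.le, e]
  have hker : signSeminorm A z ^ 2 = δ ^ 2 * ∑ i, signSum (fun j => (v j : ℝ)) (A i) ^ 2 := by
    rw [signSeminorm_sq, Finset.mul_sum]
    refine Finset.sum_congr rfl fun i _ => ?_
    have e : signSum x (A i) = 0 := hx i
    have e2 : x = z + δ • fun j => (v j : ℝ) := by
      ext j
      simp [hz]
    rw [e2, signSum_add, signSum_smul] at e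
    rw [eq_neg_of_add_eq_zero_left e]
    ring
  have hvS : 3 / 22 * m * (δ ^ 2 * ∑ j, (v j : ℝ) ^ 2) ≤
      4 * E * (1 + 2 * q) ^ 2 * (N : ℝ) ^ (2 / q) := by
    refine le_trans ?_ hGz2
    rw [hker]
    by_cases hv0 : v = 0
    · simp only [hv0, Pi.zero_apply, Int.cast_zero]
      simp only [ne_eq, OfNat.ofNat_ne_zero, not_false_eq_true, zero_pow, Finset.sum_const_zero,
        mul_zero]
      positivity
    · have := mul_le_mul_of_nonneg_left (hlow v hv0 hvM) (sq_nonneg δ)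
      linarith
  have hzS : ∑ j, z j ^ 2 ≤ 22 * D * ((N : ℝ) ^ (2 / q) / m) := by
    have h1 : ∀ j, z j ^ 2 ≤ δ ^ (2 - p) * |z j| ^ p := by
      intro j
      rcases (abs_nonneg (z j)).eq_or_lt with h | h
      · rw [← sq_abs, ← h, Real.zero_rpow hp0.ne']
        simp
      · calc z j ^ 2 = |z j| ^ (2 - p) * |z j| ^ p := by
              rw [← Real.rpow_add h, ← sq_abs, ← Real.rpow_natCast]
              norm_num
          _ ≤ _ := by
              gcongr
              exact hv2 j
    have h2 : ∑ j, z j ^ 2 ≤ δ ^ (2 - p) := by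
      calc ∑ j, z j ^ 2 ≤ ∑ j, δ ^ (2 - p) * |z j| ^ p := Finset.sum_le_sum fun j _ => h1 j
        _ = δ ^ (2 - p) * ∑ j, |z j| ^ p := by rw [Finset.mul_sum]
        _ ≤ δ ^ (2 - p) * 1 := by gcongr
        _ = _ := mul_one _
    refine h2.trans ?_
    have e1 : δ ^ (2 - p) = M ^ (2 / q - 1) := by
      rw [hδ, ← hpq, ← Real.rpow_mul hM0.le]
      congr 1
      have : (2 : ℝ) / q = 2 * (1 - 1 / p) := by rw [hpq]; ring
      rw [this]
      field_simp
      ring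
    have e2 : M ^ (2 / q - 1) * M ^ (1 - 1 / q) = M ^ (1 / q) := by
      rw [← Real.rpow_add hM0]
      congr 1
      ring
    have e3 : (N : ℝ) ^ (2 / q) = (N : ℝ) ^ (1 / q) * (N : ℝ) ^ (1 / q) := by
      rw [← Real.rpow_add hN0]
      congr 1
      ring
    rw [e1, ← mul_div_assoc, le_div_iff₀ hm0]
    calc M ^ (2 / q - 1) * m = 22 * D * (M ^ (2 / q - 1) * M ^ (1 - 1 / q) * (N : ℝ) ^ (1 / q)) := by
          nth_rewrite 1 [← hM]
          ring
      _ ≤ 22 * D * ((N : ℝ) ^ (1 / q) * (N : ℝ) ^ (1 / q)) := by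
          rw [e2]
          gcongr
      _ = _ := by rw [e3]
  have hvS' : δ ^ 2 * ∑ j, (v j : ℝ) ^ 2 ≤
      22 / 3 * (4 * E * (1 + 2 * q) ^ 2) * ((N : ℝ) ^ (2 / q) / m) := by
    rw [← mul_div_assoc, le_div_iff₀ hm0]
    linarith
  have hx2 : ∑ j, x j ^ 2 ≤ 2 * (δ ^ 2 * ∑ j, (v j : ℝ) ^ 2) + 2 * ∑ j, z j ^ 2 := by
    simp only [Finset.mul_sum, ← Finset.sum_add_distrib]
    refine Finset.sum_le_sum fun j _ => ?_
    have : x j = δ * v j + z j := by simp [hz]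
    rw [this]
    nlinarith [sq_nonneg (δ * v j - z j)]
  linarith

lemma lpNorm_eq {p : ℝ≥0∞} (hp : p ≠ ∞) {N : ℕ} (x : Fin N → ℂ) :
    lpNorm p x = (∑ i, ‖x i‖ ^ p.toReal) ^ (1 / p.toReal) := by
  simp [lpNorm, hp]

lemma lpNorm_nonneg (p : ℝ≥0∞) {N : ℕ} (x : Fin N → ℂ) : 0 ≤ lpNorm p x := by
  unfold lpNorm
  split_ifs
  · exact Real.iSup_nonneg fun _ => norm_nonneg _
  · positivity

lemma sum_rpow_le_one_of_lpNorm_le_one {p : ℝ≥0∞} (hp : p ≠ ∞) (hp0 : 0 < p.toReal) {N : ℕ}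
    {x : Fin N → ℂ} (hx : lpNorm p x ≤ 1) {r : ℝ} (hr : p.toReal ≤ r) :
    ∑ i, ‖x i‖ ^ r ≤ 1 := by
  have hs : ∑ i, ‖x i‖ ^ p.toReal ≤ 1 := by
    rw [lpNorm_eq hp] at hx
    by_contra hcon
    exact absurd hx (not_le.mpr (Real.one_lt_rpow (not_le.mp hcon) (by positivity)))
  refine le_trans (Finset.sum_le_sum fun i _ => ?_) hs
  have hi : ‖x i‖ ^ p.toReal ≤ 1 :=
    (Finset.single_le_sum (f := fun i => ‖x i‖ ^ p.toReal) (fun _ _ => by positivity)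
      (Finset.mem_univ i)).trans hs
  have hi1 : ‖x i‖ ≤ 1 := by
    by_contra hcon
    exact absurd hi (not_le.mpr (Real.one_lt_rpow (not_le.mp hcon) hp0))
  rcases (norm_nonneg (x i)).eq_or_lt with h | h
  · rw [← h, Real.zero_rpow (by linarith), Real.zero_rpow hp0.ne']
  · exact Real.rpow_le_rpow_of_exponent_ge h hi1 hr

lemma kolmogorovLp_nonneg (p1 p2 : ℝ≥0∞) (N n : ℕ) : 0 ≤ kolmogorovLp p1 p2 N n := by
  refine Real.sInf_nonneg ?_
  rintro _ ⟨L, -, rfl⟩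
  refine Real.sSup_nonneg ?_
  rintro _ ⟨x, -, rfl⟩
  refine Real.sInf_nonneg ?_
  rintro _ ⟨y, -, rfl⟩
  exact lpNorm_nonneg _ _

lemma kolmogorovLp_le {p1 p2 : ℝ≥0∞} {N n : ℕ} {r : ℝ} (hr : 0 ≤ r)
    (L : Submodule ℂ (Fin N → ℂ)) (hL : Module.finrank ℂ L < n)
    (h : ∀ x, lpNorm p1 x ≤ 1 → ∀ η > 0, ∃ y ∈ L, lpNorm p2 (x - y) ≤ r + η) :
    kolmogorovLp p1 p2 N n ≤ r := by
  unfold kolmogorovLp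
  refine csInf_le_of_le (b := sSup _) ⟨0, ?_⟩ ⟨L, hL, rfl⟩ (Real.sSup_le ?_ hr)
  · rintro _ ⟨L', -, rfl⟩
    refine Real.sSup_nonneg ?_
    rintro _ ⟨x, -, rfl⟩
    refine Real.sInf_nonneg ?_
    rintro _ ⟨y, -, rfl⟩
    exact lpNorm_nonneg _ _
  · rintro _ ⟨x, hx, rfl⟩
    refine le_of_forall_pos_le_add fun η hη => ?_
    obtain ⟨y, hy, hxy⟩ := h x hx η hη
    refine csInf_le_of_le ⟨0, ?_⟩ ⟨y, hy, rfl⟩ hxy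
    rintro _ ⟨y, -, rfl⟩
    exact lpNorm_nonneg _ _

/-- A coefficient vector whose pairing is bounded by the `ℓ_q`-norm lies in the unit ball of the
conjugate space. -/
lemma sum_rpow_le_one_of_pairing_le {p q : ℝ} (hp : 1 < p) (hq : 1 < q)
    (hpq : 1 / p = 1 - 1 / q) {N : ℕ} (y : Fin N → ℂ)
    (h : ∀ u : Fin N → ℂ, ‖∑ i, u i * y i‖ ≤ (∑ i, ‖u i‖ ^ q) ^ (1 / q)) :
    ∑ i, ‖y i‖ ^ p ≤ 1 := by
  have hp0 : p ≠ 0 := by linarith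
  have hq0 : q ≠ 0 := by linarith
  have hexp : (p - 1) * q = p := by
    have : p * q = p + q := by
      field_simp at hpq
      linarith
    linarith
  set u : Fin N → ℂ := fun i => ((‖y i‖ ^ (p - 2) : ℝ) : ℂ) * (starRingEnd ℂ) (y i) with hu
  have hterm : ∀ i, u i * y i = ((‖y i‖ ^ p : ℝ) : ℂ) := by
    intro i
    by_cases hy : y i = 0
    · simp [hy, Real.zero_rpow hp0]
    · rw [hu]
      simp only
      rw [mul_assoc, Complex.conj_mul', ← Complex.ofReal_pow, ← Complex.ofReal_mul,
        ← Real.rpow_natCast, ← Real.rpow_add (norm_pos_iff.mpr hy)]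
      norm_num
  have hnorm : ∀ i, ‖u i‖ ^ q = ‖y i‖ ^ p := by
    intro i
    by_cases hy : y i = 0
    · simp [hu, hy, Real.zero_rpow hp0, Real.zero_rpow hq0]
    · have hpos := norm_pos_iff.mpr hy
      have : ‖u i‖ = ‖y i‖ ^ (p - 1) := by
        rw [hu]
        simp only
        rw [norm_mul, RCLike.norm_conj, Complex.norm_real, Real.norm_of_nonneg (by positivity)]
        nth_rewrite 2 [← Real.rpow_one ‖y i‖]
        rw [← Real.rpow_add hpos]
        ring_nf
      rw [this, ← Real.rpow_mul hpos.le, hexp]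
  have h1 := h u
  simp only [hterm, hnorm] at h1
  rw [← Complex.ofReal_sum, Complex.norm_real, Real.norm_of_nonneg (by positivity)] at h1
  by_contra hcon
  have hlt : (∑ i, ‖y i‖ ^ p) ^ (1 / q) < (∑ i, ‖y i‖ ^ p) ^ (1 : ℝ) :=
    Real.rpow_lt_rpow_of_exponent_lt (not_le.mp hcon) (by rwa [div_lt_one (by linarith)])
  rw [Real.rpow_one] at hlt
  linarith

/-- Duality: the `ℓ_q`-distance from a Euclidean unit vector to `L` is at most the Euclidean radius
of the section of the conjugate unit ball by the annihilator of `L`. -/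
lemma exists_mem_lpNorm_sub_le {p : ℝ} {p2 : ℝ≥0∞} (hp : 1 < p) (hp2 : 1 < p2.toReal)
    (hp2' : p2 ≠ ∞) (hpq : 1 / p = 1 - 1 / p2.toReal) {N : ℕ} (L : Submodule ℂ (Fin N → ℂ))
    {R : ℝ} (hR0 : 0 ≤ R)
    (hR : ∀ y : Fin N → ℂ, (∀ l ∈ L, ∑ i, l i * y i = 0) → ∑ i, ‖y i‖ ^ p ≤ 1 →
      ∑ i, ‖y i‖ ^ 2 ≤ R ^ 2)
    (x : Fin N → ℂ) (hx : ∑ i, ‖x i‖ ^ 2 ≤ 1) {η : ℝ} (hη : 0 < η) :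
    ∃ l ∈ L, lpNorm p2 (x - l) ≤ R + η := by
  have hone : (1 : ℝ≥0∞) ≤ p2 := by
    rw [← ENNReal.ofReal_toReal hp2', ← ENNReal.ofReal_one]
    exact ENNReal.ofReal_le_ofReal hp2.le
  have : Fact (1 ≤ p2) := ⟨hone⟩
  set e := WithLp.linearEquiv p2 ℂ (Fin N → ℂ) with he
  have hnorm : ∀ u : Fin N → ℂ, ‖e.symm u‖ = (∑ i, ‖u i‖ ^ p2.toReal) ^ (1 / p2.toReal) := by
    intro u
    exact PiLp.norm_eq_sum (by linarith) _
  set L' : Submodule ℂ (PiLp p2 fun _ : Fin N => ℂ) := L.comap e.toLinearMap with hL'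
  obtain ⟨g, hg1, hgx⟩ :=
    exists_dual_vector'' ℂ (Submodule.Quotient.mk (e.symm x) :
      (PiLp p2 fun _ : Fin N => ℂ) ⧸ L')
  set φ : (Fin N → ℂ) →ₗ[ℂ] ℂ := g.toLinearMap ∘ₗ L'.mkQ ∘ₗ e.symm.toLinearMap with hφ
  have hφle : ∀ u, ‖φ u‖ ≤ (∑ i, ‖u i‖ ^ p2.toReal) ^ (1 / p2.toReal) := by
    intro u
    rw [← hnorm]
    calc ‖φ u‖ ≤ ‖g‖ * ‖(Submodule.Quotient.mk (e.symm u) :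
          (PiLp p2 fun _ : Fin N => ℂ) ⧸ L')‖ := g.le_opNorm _
      _ ≤ 1 * ‖e.symm u‖ := by
          gcongr
          exact Submodule.Quotient.norm_mk_le L' _
      _ = _ := one_mul _
  set y : Fin N → ℂ := fun i => φ (Pi.single i 1) with hy
  have hφy : ∀ u, φ u = ∑ i, u i * y i := by
    intro u
    conv_lhs => rw [← Finset.univ_sum_single u]
    rw [map_sum]
    refine Finset.sum_congr rfl fun i _ => ?_
    rw [hy, ← smul_eq_mul, ← map_smul, ← Pi.single_smul, smul_eq_mul, mul_one]
  have hann : ∀ l ∈ L, ∑ i, l i * y i = 0 := by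
    intro l hl
    rw [← hφy]
    have : L'.mkQ (e.symm l) = 0 := by
      rw [Submodule.mkQ_apply, Submodule.Quotient.mk_eq_zero]
      simpa [hL'] using hl
    simp only [hφ, LinearMap.comp_apply, LinearEquiv.coe_coe]
    rw [this, map_zero]
  have hy2 := hR y hann (sum_rpow_le_one_of_pairing_le hp hp2 hpq y fun u => by
    rw [← hφy]; exact hφle u)
  have hdist : ‖(Submodule.Quotient.mk (e.symm x) : (PiLp p2 fun _ : Fin N => ℂ) ⧸ L')‖ ≤ R := by
    have h1 : φ x = ((‖(Submodule.Quotient.mk (e.symm x) :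
        (PiLp p2 fun _ : Fin N => ℂ) ⧸ L')‖ : ℝ) : ℂ) := hgx
    have h2 : ‖φ x‖ ≤ ∑ i, ‖x i‖ * ‖y i‖ := by
      rw [hφy]
      refine (norm_sum_le _ _).trans (le_of_eq ?_)
      simp
    have h3 : (∑ i, ‖x i‖ * ‖y i‖) ^ 2 ≤ R ^ 2 := by
      calc (∑ i, ‖x i‖ * ‖y i‖) ^ 2 ≤ (∑ i, ‖x i‖ ^ 2) * ∑ i, ‖y i‖ ^ 2 :=
            Finset.sum_mul_sq_le_sq_mul_sq _ _ _
        _ ≤ 1 * R ^ 2 := by gcongr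
        _ = R ^ 2 := one_mul _
    rw [h1, Complex.norm_real, norm_norm] at h2
    exact h2.trans (le_of_abs_le (abs_le_of_sq_le_sq h3 hR0))
  obtain ⟨w, hw, hwlt⟩ := Submodule.Quotient.norm_mk_lt
    (Submodule.Quotient.mk (e.symm x) : (PiLp p2 fun _ : Fin N => ℂ) ⧸ L') hη
  refine ⟨x - e w, ?_, ?_⟩
  · rw [Submodule.Quotient.eq] at hw
    have : e (e.symm x - w) ∈ L := by
      have := L'.neg_mem hw
      rw [neg_sub] at this
      exact this
    simpa using this
  · rw [sub_sub_cancel, lpNorm_eq hp2', ← hnorm, LinearEquiv.symm_apply_apply]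
    linarith

/-- Let `1 ≤ p1 < 2 < p2 < ∞`. There is a constant `C > 0`, independent of
`N` and `n`, such that: `d_n(id : ℓ_{p1}^N → ℓ_{p2}^N) ≤ C` if `n ≤ N^{2/p2}`;
`d_n(id : ℓ_{p1}^N → ℓ_{p2}^N) ≤ C N^{1/p2} n^{-1/2}` if `N^{2/p2} < n ≤ N`; and
`d_n(id : ℓ_{p1}^N → ℓ_{p2}^N) = 0` if `n > N`. -/
theorem kolmogorov_id_lp_upper (p1 p2 : ℝ≥0∞) (hp1 : 1 ≤ p1) (hp12 : p1 < 2)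
    (hp2 : 2 < p2) (hp2' : p2 ≠ ∞) :
    ∃ C : ℝ, 0 < C ∧ ∀ N n : ℕ, 1 ≤ n →
      ((n : ℝ) ≤ (N : ℝ) ^ (2 / p2.toReal) → kolmogorovLp p1 p2 N n ≤ C) ∧
      ((N : ℝ) ^ (2 / p2.toReal) < (n : ℝ) → n ≤ N →
        kolmogorovLp p1 p2 N n ≤ C * (N : ℝ) ^ (1 / p2.toReal) * (n : ℝ) ^ (-(1 : ℝ) / 2)) ∧
      (N < n → kolmogorovLp p1 p2 N n = 0) := by
  have hp1' : p1 ≠ ∞ := ne_top_of_lt hp12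
  have h1r : 1 ≤ p1.toReal := by
    simpa using ENNReal.toReal_mono hp1' hp1
  have h12r : p1.toReal ≤ 2 := by
    simpa using ENNReal.toReal_mono ENNReal.ofNat_ne_top hp12.le
  have hq : 2 < p2.toReal := by
    simpa using (ENNReal.toReal_lt_toReal ENNReal.ofNat_ne_top hp2').mpr hp2
  set q := p2.toReal with hqdef
  set p : ℝ := q / (q - 1) with hpdef
  have hq1 : 0 < q - 1 := by linarith
  have hpq : 1 / p = 1 - 1 / q := by
    rw [hpdef]
    field_simp
  have hp_gt : 1 < p := by
    rw [hpdef, one_lt_div hq1]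
    linarith
  have hp_le : p ≤ 2 := by
    rw [hpdef, div_le_iff₀ hq1]
    linarith
  obtain ⟨C, hC, hmat⟩ := exists_matrix_ker_small hq hp_gt.le hp_le hpq
  refine ⟨1 + 2 * √C, by positivity, fun N n hn => ⟨fun _ => ?_, fun hNn hnN => ?_, fun hNn => ?_⟩⟩
  · refine (kolmogorovLp_le zero_le_one ⊥ (by rw [finrank_bot]; exact hn) fun x hx η hη =>
      ⟨0, Submodule.zero_mem _, ?_⟩).trans (le_add_of_nonneg_right (by positivity))
    rw [sub_zero, lpNorm_eq hp2']
    have h := sum_rpow_le_one_of_lpNorm_le_one hp1' (by linarith) hx (r := q) (by linarith)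
    have : (∑ i, ‖x i‖ ^ q) ^ (1 / q) ≤ 1 := Real.rpow_le_one (by positivity) h (by positivity)
    linarith
  · have hN : (1 : ℝ) ≤ N := by exact_mod_cast hn.trans hnN
    have hN0 : (0 : ℝ) < N := by linarith
    have hn2 : 2 ≤ n := by
      have : (1 : ℝ) < n := lt_of_le_of_lt (Real.one_le_rpow hN (by positivity)) hNn
      exact_mod_cast this
    have hn0 : (0 : ℝ) < n := by positivity
    obtain ⟨A, hA⟩ := hmat N (n - 1) (by omega) (by omega)
    set L : Submodule ℂ (Fin N → ℂ) :=
      Submodule.span ℂ (Set.range fun i j => ((A i j : ℝ) : ℂ)) with hL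
    have hLdim : Module.finrank ℂ L < n := by
      have h := finrank_range_le_card (R := ℂ)
        (b := fun (i : Fin (n - 1)) (j : Fin N) => ((A i j : ℝ) : ℂ))
      rw [Fintype.card_fin] at h
      exact lt_of_le_of_lt h (by omega)
    set R : ℝ := 2 * √C * (N : ℝ) ^ (1 / q) * (n : ℝ) ^ (-(1 : ℝ) / 2) with hRdef
    have hR0 : 0 ≤ R := by positivity
    have hRsq : R ^ 2 = 4 * C * ((N : ℝ) ^ (2 / q) / n) := by
      have e1 : ((N : ℝ) ^ (1 / q)) ^ 2 = (N : ℝ) ^ (2 / q) := by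
        rw [← Real.rpow_natCast, ← Real.rpow_mul hN0.le]
        congr 1
        push_cast
        ring
      have e2 : ((n : ℝ) ^ (-(1 : ℝ) / 2)) ^ 2 = (n : ℝ)⁻¹ := by
        rw [← Real.rpow_natCast, ← Real.rpow_mul hn0.le, ← Real.rpow_neg_one]
        norm_num
      rw [hRdef, mul_pow, mul_pow, mul_pow, Real.sq_sqrt hC.le, e1, e2]
      ring
    have hsection : ∀ y : Fin N → ℂ, (∀ l ∈ L, ∑ i, l i * y i = 0) → ∑ i, ‖y i‖ ^ p ≤ 1 →
        ∑ i, ‖y i‖ ^ 2 ≤ R ^ 2 := by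
      intro y hyL hyp
      have hrow : ∀ i, ∑ j, ((A i j : ℝ) : ℂ) * y j = 0 := fun i =>
        hyL _ (Submodule.subset_span ⟨i, rfl⟩)
      have hre := hA (fun j => (y j).re)
        (fun i => by simpa [Complex.re_sum] using congrArg Complex.re (hrow i))
        ((Finset.sum_le_sum fun j _ => Real.rpow_le_rpow (abs_nonneg _)
          (Complex.abs_re_le_norm (y j)) (by linarith)).trans hyp)
      have him := hA (fun j => (y j).im)
        (fun i => by simpa [Complex.im_sum] using congrArg Complex.im (hrow i))
        ((Finset.sum_le_sum fun j _ => Real.rpow_le_rpow (abs_nonneg _)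
          (Complex.abs_im_le_norm (y j)) (by linarith)).trans hyp)
      have hsum : ∑ i, ‖y i‖ ^ 2 = ∑ i, (y i).re ^ 2 + ∑ i, (y i).im ^ 2 := by
        rw [← Finset.sum_add_distrib]
        refine Finset.sum_congr rfl fun i _ => ?_
        rw [Complex.sq_norm, Complex.normSq_apply]
        ring
      have hdiv : (N : ℝ) ^ (2 / q) / ((n - 1 : ℕ) : ℝ) ≤ 2 * ((N : ℝ) ^ (2 / q) / n) := by
        have hcast : ((n - 1 : ℕ) : ℝ) = n - 1 := by
          rw [Nat.cast_sub hn, Nat.cast_one]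
        have hn2' : (2 : ℝ) ≤ n := by exact_mod_cast hn2
        have hNq : 0 < (N : ℝ) ^ (2 / q) := by positivity
        rw [hcast, ← mul_div_assoc, div_le_div_iff₀ (by linarith) hn0]
        nlinarith
      have := mul_le_mul_of_nonneg_left hdiv hC.le
      rw [hsum, hRsq]
      linarith
    refine (kolmogorovLp_le hR0 L hLdim fun x hx η hη => ?_).trans ?_
    · refine exists_mem_lpNorm_sub_le hp_gt (by linarith) hp2' hpq L hR0 hsection x ?_ hη
      have := sum_rpow_le_one_of_lpNorm_le_one hp1' (by linarith) hx h12r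
      simpa using this
    · rw [hRdef]
      gcongr
      linarith
  · refine le_antisymm (kolmogorovLp_le le_rfl ⊤ (by simpa using hNn) fun x _ η hη =>
      ⟨x, Submodule.mem_top, ?_⟩) (kolmogorovLp_nonneg _ _ _ _)
    have hq0 : (q : ℝ) ≠ 0 := by linarith
    have h0 : lpNorm p2 (x - x) = 0 := by
      rw [lpNorm_eq hp2']
      simp [← hqdef, Real.zero_rpow hq0, Real.zero_rpow (inv_ne_zero hq0)]
    rw [h0]
    linarith
end

section
/- Let 2 ≤ p1 ≤ p2 ≤ ∞. Then there exists a constant c > 0, depending only on p1 and p2, such that for all N ∈ ℕ and all n ∈ ℕ with n ≤ N/4 one has c^{-1} ≤ c_n(id : ℓ_{p1}^N → ℓ_{p2}^N) ≤ c, i.e. c_n(id, ℓ_{p1}^N, ℓ_{p2}^N) ∼ 1. -/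
open scoped ENNReal Classical

/-- The `n`-th Gelfand number of the identity map `id : ℓ_{p1}^N → ℓ_{p2}^N`:
the infimum, over all (automatically closed) linear subspaces `M` of `ℓ_{p1}^N` of
codimension `< n`, of `sup { ‖x‖_{p2} : x ∈ M, ‖x‖_{p1} ≤ 1 }`. -/
noncomputable def gelfandLp (p1 p2 : ℝ≥0∞) (N n : ℕ) : ℝ :=
  sInf { r : ℝ | ∃ M : Submodule ℂ (Fin N → ℂ),
    Module.finrank ℂ ((Fin N → ℂ) ⧸ M) < n ∧
    r = sSup { t : ℝ | ∃ x ∈ M, lpNorm p1 x ≤ 1 ∧ t = lpNorm p2 x } }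

theorem norm_apply_le_lpNorm {p : ℝ≥0∞} (hp : 0 < p) {N : ℕ} (x : Fin N → ℂ) (i : Fin N) :
    ‖x i‖ ≤ lpNorm p x := by
  unfold lpNorm
  split_ifs with h
  · exact le_ciSup (f := fun i => ‖x i‖) (Set.finite_range _).bddAbove i
  · have hpr : 0 < p.toReal := ENNReal.toReal_pos hp.ne' h
    rw [one_div, Real.le_rpow_inv_iff_of_pos (norm_nonneg _) (by positivity) hpr]
    exact Finset.single_le_sum (f := fun i => ‖x i‖ ^ p.toReal) (fun _ _ => by positivity)
      (Finset.mem_univ i)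

theorem lpNorm_le_one_iff_sum_le_one {p : ℝ≥0∞} (hp : 0 < p) (h : p ≠ ∞) {N : ℕ}
    (x : Fin N → ℂ) : lpNorm p x ≤ 1 ↔ ∑ i, ‖x i‖ ^ p.toReal ≤ 1 := by
  have hpr : 0 < p.toReal := ENNReal.toReal_pos hp.ne' h
  rw [lpNorm, if_neg h, one_div, Real.rpow_inv_le_iff_of_pos (by positivity) zero_le_one hpr,
    Real.one_rpow]

theorem lpNorm_le_one_of_exponent_le {p q : ℝ≥0∞} (hp : 0 < p) (hpq : p ≤ q) {N : ℕ}
    {x : Fin N → ℂ} (hx : lpNorm p x ≤ 1) : lpNorm q x ≤ 1 := by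
  have hle (i : Fin N) : ‖x i‖ ≤ 1 := (norm_apply_le_lpNorm hp x i).trans hx
  by_cases hq : q = ∞
  · rw [lpNorm, if_pos hq]
    exact Real.iSup_le hle zero_le_one
  · have hp' : p ≠ ∞ := ne_top_of_le_ne_top hq hpq
    rw [lpNorm_le_one_iff_sum_le_one hp hp'] at hx
    rw [lpNorm_le_one_iff_sum_le_one (hp.trans_le hpq) hq]
    refine (Finset.sum_le_sum fun i _ => ?_).trans hx
    exact Real.rpow_le_rpow_of_exponent_ge_of_imp (norm_nonneg _) (hle i)
      (ENNReal.toReal_mono hq hpq) fun _ h => absurd h (ENNReal.toReal_pos (hp.trans_le hpq).ne' hq).ne'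

/-- A subspace of Euclidean space contains a vector of norm at most one having a coordinate
at least the relative dimension of the subspace. -/
theorem exists_mem_norm_le_one_finrank_le {ι : Type*} [Fintype ι] [Nonempty ι]
    (M : Submodule ℂ (EuclideanSpace ℂ ι)) :
    ∃ x ∈ M, ‖x‖ ≤ 1 ∧ ∃ i, (Module.finrank ℂ M : ℝ) / Fintype.card ι ≤ ‖x i‖ := by
  let b := EuclideanSpace.basisFun ι ℂ
  have htr : ∑ i, (M.starProjection (b i)) i = Module.finrank ℂ M := by
    have h := LinearMap.trace_eq_sum_inner (M.starProjection : _ →ₗ[ℂ] _) b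
    have hproj : LinearMap.IsProj M (M.starProjection : _ →ₗ[ℂ] _) :=
      ⟨fun x => by simp, fun x hx => by simpa using M.starProjection_eq_self_iff.2 hx⟩
    rw [hproj.trace] at h
    simpa [b, EuclideanSpace.inner_single_left] using h.symm
  have hcard : (0 : ℝ) < Fintype.card ι := by exact_mod_cast Fintype.card_pos
  have hsum : ∑ _i : ι, (Module.finrank ℂ M : ℝ) / Fintype.card ι ≤
      ∑ i, ‖(M.starProjection (b i)) i‖ := by
    calc
      _ = (Module.finrank ℂ M : ℝ) := by simp [mul_div_cancel₀ _ hcard.ne']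
      _ = ‖∑ i, (M.starProjection (b i)) i‖ := by simp [htr]
      _ ≤ _ := norm_sum_le _ _
  obtain ⟨i, -, hi⟩ := Finset.exists_le_of_sum_le Finset.univ_nonempty hsum
  refine ⟨M.starProjection (b i), M.starProjection_apply_mem _, ?_, i, hi⟩
  exact (M.norm_starProjection_apply_le _).trans (b.norm_eq_one i).le

theorem exists_mem_lpNorm_le_one_half_le {p q : ℝ≥0∞} (hp : 2 ≤ p) (hq : 0 < q) {N : ℕ}
    (M : Submodule ℂ (Fin N → ℂ)) (hN : 0 < N)
    (hM : 2 * Module.finrank ℂ ((Fin N → ℂ) ⧸ M) ≤ N) :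
    ∃ x ∈ M, lpNorm p x ≤ 1 ∧ 1 / 2 ≤ lpNorm q x := by
  have : Nonempty (Fin N) := ⟨⟨0, hN⟩⟩
  let e := (WithLp.linearEquiv 2 ℂ (Fin N → ℂ)).symm
  obtain ⟨x, hxM, hx, i, hi⟩ :=
    exists_mem_norm_le_one_finrank_le (M.map (e : (Fin N → ℂ) →ₗ[ℂ] EuclideanSpace ℂ (Fin N)))
  obtain ⟨y, hyM, rfl⟩ := hxM
  have hdim := M.finrank_quotient_add_finrank
  rw [Module.finrank_fin_fun] at hdim
  have hhalf : (1 / 2 : ℝ) ≤ ‖y i‖ := by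
    refine le_trans ?_ hi
    rw [LinearEquiv.finrank_map_eq, Fintype.card_fin, div_le_div_iff₀ two_pos (by exact_mod_cast hN)]
    exact_mod_cast (by lia : 1 * N ≤ Module.finrank ℂ M * 2)
  refine ⟨y, hyM, lpNorm_le_one_of_exponent_le two_pos hp ?_,
    hhalf.trans (norm_apply_le_lpNorm hq y i)⟩
  rw [lpNorm_le_one_iff_sum_le_one two_pos ENNReal.ofNat_ne_top]
  have hsq := pow_le_one₀ (n := 2) (norm_nonneg _) hx
  rw [EuclideanSpace.norm_sq_eq] at hsq
  simpa [e] using hsq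

/-- Let `2 ≤ p1 ≤ p2 ≤ ∞`. There is a constant `c > 0`, depending only on
`p1, p2`, such that for all `N` and all `n` with `n ≤ N/4`,
`c⁻¹ ≤ c_n(id : ℓ_{p1}^N → ℓ_{p2}^N) ≤ c`. -/
theorem gelfand_id_lp_ge_two (p1 p2 : ℝ≥0∞) (hp1 : 2 ≤ p1) (hp12 : p1 ≤ p2) :
    ∃ c : ℝ, 0 < c ∧ ∀ N n : ℕ, 1 ≤ n → (n : ℝ) ≤ (N : ℝ) / 4 →
      c⁻¹ ≤ gelfandLp p1 p2 N n ∧ gelfandLp p1 p2 N n ≤ c := by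
  have h1 : 0 < p1 := two_pos.trans_le hp1
  have h2 : 0 < p2 := h1.trans_le hp12
  have hbdd {N : ℕ} (M : Submodule ℂ (Fin N → ℂ)) :
      1 ∈ upperBounds { t : ℝ | ∃ x ∈ M, lpNorm p1 x ≤ 1 ∧ t = lpNorm p2 x } := by
    rintro t ⟨x, -, hx, rfl⟩
    exact lpNorm_le_one_of_exponent_le h1 hp12 hx
  refine ⟨2, two_pos, fun N n hn hnN => ?_⟩
  have hnN' : 4 * n ≤ N := by
    have : (4 * n : ℝ) ≤ N := by linarith
    exact_mod_cast this
  have htop : Module.finrank ℂ ((Fin N → ℂ) ⧸ (⊤ : Submodule ℂ (Fin N → ℂ))) < n := by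
    rw [Module.finrank_zero_of_subsingleton]
    exact hn
  have hlow : ∀ r ∈ { r : ℝ | ∃ M : Submodule ℂ (Fin N → ℂ),
      Module.finrank ℂ ((Fin N → ℂ) ⧸ M) < n ∧
      r = sSup { t : ℝ | ∃ x ∈ M, lpNorm p1 x ≤ 1 ∧ t = lpNorm p2 x } }, (2 : ℝ)⁻¹ ≤ r := by
    rintro r ⟨M, hM, rfl⟩
    obtain ⟨x, hxM, hx, hx'⟩ := exists_mem_lpNorm_le_one_half_le hp1 h2 M (by lia) (by lia)
    rw [← one_div]
    exact hx'.trans (le_csSup ⟨1, hbdd M⟩ ⟨x, hxM, hx, rfl⟩)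
  refine ⟨le_csInf ⟨_, ⊤, htop, rfl⟩ hlow, ?_⟩
  refine (csInf_le ⟨_, hlow⟩ ⟨⊤, htop, rfl⟩).trans ?_
  exact (Real.sSup_le (hbdd ⊤) zero_le_one).trans one_le_two
end
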